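/- arXiv:math/9904113 — 2 statements merged into one kernel-verified Lean document; each statement's English description precedes it below -/
import Mathlib

section
/- Let L𝔫₊ = 𝔫₊ ⊗ C[t,t⁻¹] be the loop algebra of the positive nilpotent subalgebra of a finite-dimensional semisimple Lie algebra 𝔤 with Cartan matrix (a_{ij}) and generators ē_i of 𝔫₊. Let F̃₊ be the Lie algebra with generators x̃_i[k] (1 ≤ i ≤ n, k ∈ ℤ) and relations given by the coefficients of: (z−w)[x̃_i(z), x̃_j(w)] = 0 and ad(x̃_i(z₁))⋯ad(x̃_i(z_{1−a_{ij}}))(x̃_j(w)) = 0 for i ≠ j, where x̃_i(z) = Σ_k x̃_i[k] z^{−k}. Then the assignment x̃_i[k] ↦ ē_i ⊗ tᵏ defines a Lie algebra isomorphism F̃₊ ≅ L𝔫₊. -/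
open TensorProduct

variable {n : ℕ}

/-- The Serre relations `ad(ē_i)^{1-a_{ij}}(ē_j)` in the free Lie algebra on `n`
generators. -/
def serreSet (A : Matrix (Fin n) (Fin n) ℤ) : Set (FreeLieAlgebra ℂ (Fin n)) :=
  {z | ∃ i j : Fin n, i ≠ j ∧
    z = ((LieAlgebra.ad ℂ (FreeLieAlgebra ℂ (Fin n)) (FreeLieAlgebra.of ℂ i))
          ^ (1 - A i j).toNat) (FreeLieAlgebra.of ℂ j)}

/-- The positive nilpotent Lie algebra `𝔫₊`, presented by generators `ē_i` and the Serre
relations. -/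
def nPlus (A : Matrix (Fin n) (Fin n) ℤ) :=
  FreeLieAlgebra ℂ (Fin n) ⧸ LieSubmodule.lieSpan ℂ (FreeLieAlgebra ℂ (Fin n)) (serreSet A)

noncomputable instance (A : Matrix (Fin n) (Fin n) ℤ) : LieRing (nPlus A) :=
  inferInstanceAs (LieRing (FreeLieAlgebra ℂ (Fin n) ⧸
    LieSubmodule.lieSpan ℂ (FreeLieAlgebra ℂ (Fin n)) (serreSet A)))

noncomputable instance (A : Matrix (Fin n) (Fin n) ℤ) : LieAlgebra ℂ (nPlus A) :=
  inferInstanceAs (LieAlgebra ℂ (FreeLieAlgebra ℂ (Fin n) ⧸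
    LieSubmodule.lieSpan ℂ (FreeLieAlgebra ℂ (Fin n)) (serreSet A)))

/-- The generator `ē_i` of `𝔫₊`. -/
noncomputable def nPlusGen (A : Matrix (Fin n) (Fin n) ℤ) (i : Fin n) : nPlus A :=
  LieSubmodule.Quotient.mk
    (N := LieSubmodule.lieSpan ℂ (FreeLieAlgebra ℂ (Fin n)) (serreSet A))
    (FreeLieAlgebra.of ℂ i)

/-- The defining relations of `F̃₊`: the coefficients of `(z-w)[x̃_i(z), x̃_j(w)] = 0`
together with the field Serre relations
`ad(x̃_i(z₁))⋯ad(x̃_i(z_{1-a_{ij}}))(x̃_j(w)) = 0`. -/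
def loopRels (A : Matrix (Fin n) (Fin n) ℤ) : Set (FreeLieAlgebra ℂ (Fin n × ℤ)) :=
  {z | ∃ (i j : Fin n) (k l : ℤ),
      z = ⁅FreeLieAlgebra.of ℂ (i, k + 1), FreeLieAlgebra.of ℂ (j, l)⁆
          - ⁅FreeLieAlgebra.of ℂ (i, k), FreeLieAlgebra.of ℂ (j, l + 1)⁆} ∪
  {z | ∃ i j : Fin n, i ≠ j ∧ ∃ (ks : List ℤ) (l : ℤ), ks.length = (1 - A i j).toNat ∧
      z = ks.foldr (fun t acc => ⁅FreeLieAlgebra.of ℂ (i, t), acc⁆)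
            (FreeLieAlgebra.of ℂ (j, l))}

/-- The Lie algebra `F̃₊`, presented by the generators `x̃_i[k]` and the relations
`loopRels`. -/
def FPlus (A : Matrix (Fin n) (Fin n) ℤ) :=
  FreeLieAlgebra ℂ (Fin n × ℤ) ⧸
    LieSubmodule.lieSpan ℂ (FreeLieAlgebra ℂ (Fin n × ℤ)) (loopRels A)

noncomputable instance (A : Matrix (Fin n) (Fin n) ℤ) : LieRing (FPlus A) :=
  inferInstanceAs (LieRing (FreeLieAlgebra ℂ (Fin n × ℤ) ⧸
    LieSubmodule.lieSpan ℂ (FreeLieAlgebra ℂ (Fin n × ℤ)) (loopRels A)))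

noncomputable instance (A : Matrix (Fin n) (Fin n) ℤ) : LieAlgebra ℂ (FPlus A) :=
  inferInstanceAs (LieAlgebra ℂ (FreeLieAlgebra ℂ (Fin n × ℤ) ⧸
    LieSubmodule.lieSpan ℂ (FreeLieAlgebra ℂ (Fin n × ℤ)) (loopRels A)))

/-- The generator `x̃_i[k]` of `F̃₊`. -/
noncomputable def FPlusGen (A : Matrix (Fin n) (Fin n) ℤ) (i : Fin n) (k : ℤ) : FPlus A :=
  LieSubmodule.Quotient.mk
    (N := LieSubmodule.lieSpan ℂ (FreeLieAlgebra ℂ (Fin n × ℤ)) (loopRels A))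
    (FreeLieAlgebra.of ℂ (i, k))

/-- The loop algebra `L·𝔩 = 𝔩 ⊗ ℂ[t, t⁻¹]`, as a Lie algebra over `ℂ`. -/
def LoopAlg (L : Type*) [LieRing L] [LieAlgebra ℂ L] :=
  RestrictScalars ℂ (LaurentPolynomial ℂ) ((LaurentPolynomial ℂ) ⊗[ℂ] L)

noncomputable instance (L : Type*) [LieRing L] [LieAlgebra ℂ L] : LieRing (LoopAlg L) :=
  inferInstanceAs (LieRing
    (RestrictScalars ℂ (LaurentPolynomial ℂ) ((LaurentPolynomial ℂ) ⊗[ℂ] L)))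

noncomputable instance (L : Type*) [LieRing L] [LieAlgebra ℂ L] :
    LieAlgebra ℂ (LoopAlg L) :=
  inferInstanceAs (LieAlgebra ℂ
    (RestrictScalars ℂ (LaurentPolynomial ℂ) ((LaurentPolynomial ℂ) ⊗[ℂ] L)))

/-- The element `x ⊗ tᵏ` of the loop algebra. -/
noncomputable def loopOf (L : Type*) [LieRing L] [LieAlgebra ℂ L] (k : ℤ) (x : L) :
    LoopAlg L :=
  (RestrictScalars.addEquiv ℂ (LaurentPolynomial ℂ) ((LaurentPolynomial ℂ) ⊗[ℂ] L)).symm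
    ((LaurentPolynomial.T k) ⊗ₜ[ℂ] x)

set_option linter.unusedSectionVars false
namespace LoopPf

/-- Lift of a Lie hom to a quotient. -/
noncomputable def quotLift {L L' : Type*} [LieRing L] [LieAlgebra ℂ L] [LieRing L'] [LieAlgebra ℂ L']
    (I : LieIdeal ℂ L) (f : L →ₗ⁅ℂ⁆ L') (h : I ≤ f.ker) : L ⧸ I →ₗ⁅ℂ⁆ L' :=
  { Submodule.liftQ I.toSubmodule (f : L →ₗ[ℂ] L') (fun x hx => by
      have := h hx
      simpa using this) with
    map_lie' := by
      intro x y
      obtain ⟨x, rfl⟩ := Submodule.Quotient.mk_surjective _ x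
      obtain ⟨y, rfl⟩ := Submodule.Quotient.mk_surjective _ y
      exact f.map_lie x y }

theorem quotLift_mk {L L' : Type*} [LieRing L] [LieAlgebra ℂ L] [LieRing L'] [LieAlgebra ℂ L']
    (I : LieIdeal ℂ L) (f : L →ₗ⁅ℂ⁆ L') (h : I ≤ f.ker) (x : L) :
    quotLift I f h (LieSubmodule.Quotient.mk x) = f x := rfl

/-- The quotient map as a Lie hom. -/
noncomputable def quotMk {L : Type*} [LieRing L] [LieAlgebra ℂ L] (I : LieIdeal ℂ L) :
    L →ₗ⁅ℂ⁆ L ⧸ I :=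
  { (LieSubmodule.Quotient.mk' I : L →ₗ[ℂ] L ⧸ I) with
    map_lie' := by intro x y; rfl }

variable (A : Matrix (Fin n) (Fin n) ℤ)

/-- First family of relations. -/
def R1 {L : Type*} [LieRing L] (g : Fin n → ℤ → L) : Prop :=
  ∀ i j k l, ⁅g i (k + 1), g j l⁆ = ⁅g i k, g j (l + 1)⁆

/-- Second family of relations. -/
def R2 {L : Type*} [LieRing L] (g : Fin n → ℤ → L) : Prop :=
  ∀ i j, i ≠ j → ∀ (ks : List ℤ) (l : ℤ), ks.length = (1 - A i j).toNat →
    ks.foldr (fun t acc => ⁅g i t, acc⁆) (g j l) = 0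

theorem map_foldr {L L' : Type*} [LieRing L] [LieAlgebra ℂ L] [LieRing L'] [LieAlgebra ℂ L']
    (f : L →ₗ⁅ℂ⁆ L') (u : ℤ → L) (v : L) (ks : List ℤ) :
    f (ks.foldr (fun t acc => ⁅u t, acc⁆) v) = ks.foldr (fun t acc => ⁅f (u t), acc⁆) (f v) := by
  induction ks with
  | nil => rfl
  | cons a ks ih => simp only [List.foldr_cons, LieHom.map_lie, ih]

noncomputable def Fmk : FreeLieAlgebra ℂ (Fin n × ℤ) →ₗ⁅ℂ⁆ FPlus A :=
  quotMk (LieSubmodule.lieSpan ℂ (FreeLieAlgebra ℂ (Fin n × ℤ)) (loopRels A))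

theorem Fmk_of (i : Fin n) (k : ℤ) : Fmk A (FreeLieAlgebra.of ℂ (i, k)) = FPlusGen A i k := rfl

theorem Fmk_surj : Function.Surjective (Fmk A) := Quot.mk_surjective

theorem Fmk_zero {z} (h : z ∈ loopRels A) : Fmk A z = 0 :=
  LieSubmodule.Quotient.mk_eq_zero'.2 (LieSubmodule.subset_lieSpan h)

theorem F_R1 : R1 (FPlusGen A) := by
  intro i j k l
  have := Fmk_zero A (Or.inl ⟨i, j, k, l, rfl⟩)
  rw [map_sub, LieHom.map_lie, LieHom.map_lie, sub_eq_zero] at this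
  exact this

theorem F_R2 : R2 A (FPlusGen A) := by
  intro i j h ks l hl
  have := Fmk_zero A (Or.inr ⟨i, j, h, ks, l, hl, rfl⟩)
  rw [map_foldr] at this
  exact this

theorem exists_Flift {L : Type*} [LieRing L] [LieAlgebra ℂ L] (g : Fin n → ℤ → L)
    (h1 : R1 g) (h2 : R2 A g) : ∃ f : FPlus A →ₗ⁅ℂ⁆ L, ∀ i k, f (FPlusGen A i k) = g i k := by
  let f0 : FreeLieAlgebra ℂ (Fin n × ℤ) →ₗ⁅ℂ⁆ L := FreeLieAlgebra.lift ℂ (fun p => g p.1 p.2)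
  have hf0 : ∀ i k, f0 (FreeLieAlgebra.of ℂ (i, k)) = g i k := fun i k => by simp [f0]
  refine ⟨quotLift (LieSubmodule.lieSpan ℂ (FreeLieAlgebra ℂ (Fin n × ℤ)) (loopRels A)) f0 ?_, ?_⟩
  · rw [LieSubmodule.lieSpan_le]
    rintro z (⟨i, j, k, l, rfl⟩ | ⟨i, j, hij, ks, l, hl, rfl⟩)
    · simp only [SetLike.mem_coe, LieHom.mem_ker, map_sub, LieHom.map_lie, hf0, h1 i j k l, sub_self]
    · simp only [SetLike.mem_coe, LieHom.mem_ker, map_foldr, hf0]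
      exact h2 i j hij ks l hl
  · intro i k
    exact hf0 i k

theorem F_top (S : LieSubalgebra ℂ (FPlus A)) (h : ∀ i k, FPlusGen A i k ∈ S) (y : FPlus A) :
    y ∈ S := by
  let T : LieSubalgebra ℂ (FreeLieAlgebra ℂ (Fin n × ℤ)) := S.comap (Fmk A)
  let g : FreeLieAlgebra ℂ (Fin n × ℤ) →ₗ⁅ℂ⁆ T :=
    FreeLieAlgebra.lift ℂ (fun p => ⟨FreeLieAlgebra.of ℂ p, h p.1 p.2⟩)
  have : T.incl.comp g = LieHom.id := by
    apply FreeLieAlgebra.hom_ext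
    intro x
    simp [g]
  obtain ⟨z, rfl⟩ := Fmk_surj A y
  have h2 : z = T.incl (g z) := (LieHom.congr_fun this z).symm
  have h3 : z ∈ T := by rw [h2]; exact (g z).2
  exact h3

/-- Induction principle. -/
theorem F_ind {p : FPlus A → Prop} (h0 : p 0) (hadd : ∀ x y, p x → p y → p (x + y))
    (hsmul : ∀ (c : ℂ) x, p x → p (c • x)) (hlie : ∀ x y, p x → p y → p ⁅x, y⁆)
    (hg : ∀ i k, p (FPlusGen A i k)) (y : FPlus A) : p y :=
  F_top A { carrier := {y | p y}, add_mem' := fun {a b} ha hb => hadd a b ha hb, zero_mem' := h0,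
            smul_mem' := fun c x hx => hsmul c x hx, lie_mem' := fun {a b} ha hb => hlie a b ha hb } hg y

noncomputable def Nmk : FreeLieAlgebra ℂ (Fin n) →ₗ⁅ℂ⁆ nPlus A :=
  quotMk (LieSubmodule.lieSpan ℂ (FreeLieAlgebra ℂ (Fin n)) (serreSet A))

theorem Nmk_surj : Function.Surjective (Nmk A) := Quot.mk_surjective

theorem map_adpow {L L' : Type*} [LieRing L] [LieAlgebra ℂ L] [LieRing L'] [LieAlgebra ℂ L']
    (f : L →ₗ⁅ℂ⁆ L') (u v : L) (N : ℕ) :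
    f ((LieAlgebra.ad ℂ L u ^ N) v) = (LieAlgebra.ad ℂ L' (f u) ^ N) (f v) := by
  induction N with
  | zero => rfl
  | succ N ih => simp only [pow_succ', Module.End.mul_apply, LieAlgebra.ad_apply, LieHom.map_lie, ih]

theorem N_serre (i j : Fin n) (h : i ≠ j) :
    (LieAlgebra.ad ℂ (nPlus A) (nPlusGen A i) ^ (1 - A i j).toNat) (nPlusGen A j) = 0 := by
  have : Nmk A _ = 0 := LieSubmodule.Quotient.mk_eq_zero'.2
    (LieSubmodule.subset_lieSpan (s := serreSet A) ⟨i, j, h, rfl⟩)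
  rw [map_adpow] at this
  exact this

theorem exists_Nlift {L : Type*} [LieRing L] [LieAlgebra ℂ L] (g : Fin n → L)
    (h : ∀ i j, i ≠ j → (LieAlgebra.ad ℂ L (g i) ^ (1 - A i j).toNat) (g j) = 0) :
    ∃ f : nPlus A →ₗ⁅ℂ⁆ L, ∀ i, f (nPlusGen A i) = g i := by
  let f0 : FreeLieAlgebra ℂ (Fin n) →ₗ⁅ℂ⁆ L := FreeLieAlgebra.lift ℂ g
  have hf0 : ∀ i, f0 (FreeLieAlgebra.of ℂ i) = g i := fun i => by simp [f0]
  refine ⟨quotLift (LieSubmodule.lieSpan ℂ (FreeLieAlgebra ℂ (Fin n)) (serreSet A)) f0 ?_, ?_⟩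
  · rw [LieSubmodule.lieSpan_le]
    rintro z ⟨i, j, hij, rfl⟩
    simp only [SetLike.mem_coe, LieHom.mem_ker, map_adpow, hf0]
    exact h i j hij
  · intro i
    exact hf0 i

theorem N_top (S : LieSubalgebra ℂ (nPlus A)) (h : ∀ i, nPlusGen A i ∈ S) (y : nPlus A) :
    y ∈ S := by
  let T : LieSubalgebra ℂ (FreeLieAlgebra ℂ (Fin n)) := S.comap (Nmk A)
  let g : FreeLieAlgebra ℂ (Fin n) →ₗ⁅ℂ⁆ T :=
    FreeLieAlgebra.lift ℂ (fun p => ⟨FreeLieAlgebra.of ℂ p, h p⟩)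
  have : T.incl.comp g = LieHom.id := by
    apply FreeLieAlgebra.hom_ext
    intro x
    simp [g]
  obtain ⟨z, rfl⟩ := Nmk_surj A y
  have h2 : z = T.incl (g z) := (LieHom.congr_fun this z).symm
  have h3 : z ∈ T := by rw [h2]; exact (g z).2
  exact h3

/-! Consequences of `R1`. -/
section R1
variable {L : Type*} [LieRing L] [LieAlgebra ℂ L] {g : Fin n → ℤ → L}

theorem R1.shift (h : R1 g) (i j : Fin n) (k l m : ℤ) : ⁅g i (k + m), g j l⁆ = ⁅g i k, g j (l + m)⁆ := by
  induction m using Int.induction_on generalizing k l with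
  | zero => simp
  | succ m ih =>
    rw [← add_assoc, h, ih, add_assoc, add_comm 1, ← add_assoc]
  | pred m ih =>
    have h1 := ih k (l - 1)
    have h2 := h i j (k + (-m - 1)) (l - 1)
    rw [show k + (-(m:ℤ) - 1) + 1 = k + -m by ring, show l - 1 + 1 = l by ring] at h2
    rw [← h2, h1]
    congr 2; ring

theorem R1.sum (h : R1 g) (i j : Fin n) {k l k' l' : ℤ} (e : k + l = k' + l') :
    ⁅g i k, g j l⁆ = ⁅g i k', g j l'⁆ := by
  have := h.shift i j k' l (k - k')
  rw [show k' + (k - k') = k by ring, show l + (k - k') = l' by linarith] at this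
  exact this

theorem R1.comm (h : R1 g) (i : Fin n) (k l : ℤ) : ⁅g i k, g i l⁆ = 0 := by
  have h1 : ⁅g i k, g i l⁆ = ⁅g i l, g i k⁆ := h.sum i i (add_comm k l)
  have h2 := lie_skew (g i l) (g i k)
  rw [← h1] at h2
  have h3 : (2 : ℂ) • ⁅g i k, g i l⁆ = 0 := by
    rw [two_smul]; exact add_eq_zero_iff_neg_eq.2 h2
  simpa using h3

theorem R1.move (h : R1 g) (i j : Fin n) (k l : ℤ) (N : ℕ) :
    ⁅g i k, (LieAlgebra.ad ℂ L (g i 0) ^ N) (g j l)⁆ =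
      (LieAlgebra.ad ℂ L (g i 0) ^ (N + 1)) (g j (l + k)) := by
  induction N with
  | zero => simpa using h.sum i j (by ring)
  | succ N ih =>
    rw [pow_succ', Module.End.mul_apply, LieAlgebra.ad_apply, leibniz_lie, h.comm, zero_lie, zero_add, ih,
      pow_succ' _ (N + 1), Module.End.mul_apply, LieAlgebra.ad_apply]

theorem R1.foldr (h : R1 g) (i j : Fin n) (ks : List ℤ) (l : ℤ) :
    ks.foldr (fun t acc => ⁅g i t, acc⁆) (g j l) =
      (LieAlgebra.ad ℂ L (g i 0) ^ ks.length) (g j (l + ks.sum)) := by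
  induction ks with
  | nil => simp
  | cons a ks ih =>
    rw [List.foldr_cons, ih, h.move, List.length_cons, List.sum_cons]
    congr 2; ring

theorem R1.r2 (h : R1 g) (h2 : ∀ i j, i ≠ j → ∀ l,
    (LieAlgebra.ad ℂ L (g i 0) ^ (1 - A i j).toNat) (g j l) = 0) : R2 A g := by
  intro i j hij ks l hl
  rw [h.foldr, hl, h2 i j hij]

theorem R1.serre (h : R1 g) (h2 : R2 A g) (i j : Fin n) (hij : i ≠ j) (l : ℤ) :
    (LieAlgebra.ad ℂ L (g i 0) ^ (1 - A i j).toNat) (g j l) = 0 := by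
  have := h2 i j hij (List.replicate (1 - A i j).toNat 0) l (by simp)
  rw [h.foldr] at this
  simpa using this
end R1
/-! The auxiliary Lie algebra encoding twisted derivations. -/
section Q
variable (L : Type*) [LieRing L] [LieAlgebra ℂ L]

/-- Triples `(x, D, y)`. -/
def Q := L × LieDerivation ℂ L L × L

noncomputable instance : AddCommGroup (Q L) := inferInstanceAs (AddCommGroup (L × LieDerivation ℂ L L × L))
noncomputable instance : Module ℂ (Q L) := inferInstanceAs (Module ℂ (L × LieDerivation ℂ L L × L))

variable {L}
/-- Constructor. -/
def Q.mk (x : L) (D : LieDerivation ℂ L L) (y : L) : Q L := (x, D, y)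
/-- First component. -/
def Q.p (q : Q L) : L := q.1
/-- Second component. -/
def Q.c (q : Q L) : LieDerivation ℂ L L := q.2.1
/-- Third component. -/
def Q.d (q : Q L) : L := q.2.2

theorem Q.ext {a b : Q L} (h1 : a.p = b.p) (h2 : a.c = b.c) (h3 : a.d = b.d) : a = b :=
  Prod.ext h1 (Prod.ext h2 h3)

@[simp] theorem Q.mk_p (x : L) (D : LieDerivation ℂ L L) (y : L) : (Q.mk x D y).p = x := rfl
@[simp] theorem Q.mk_c (x : L) (D : LieDerivation ℂ L L) (y : L) : (Q.mk x D y).c = D := rfl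
@[simp] theorem Q.mk_d (x : L) (D : LieDerivation ℂ L L) (y : L) : (Q.mk x D y).d = y := rfl
@[simp] theorem Q.zero_p : (0 : Q L).p = 0 := rfl
@[simp] theorem Q.zero_c : (0 : Q L).c = 0 := rfl
@[simp] theorem Q.zero_d : (0 : Q L).d = 0 := rfl
@[simp] theorem Q.add_p (a b : Q L) : (a + b).p = a.p + b.p := rfl
@[simp] theorem Q.add_c (a b : Q L) : (a + b).c = a.c + b.c := rfl
@[simp] theorem Q.add_d (a b : Q L) : (a + b).d = a.d + b.d := rfl
@[simp] theorem Q.smul_p (r : ℂ) (b : Q L) : (r • b).p = r • b.p := rfl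
@[simp] theorem Q.smul_c (r : ℂ) (b : Q L) : (r • b).c = r • b.c := rfl
@[simp] theorem Q.smul_d (r : ℂ) (b : Q L) : (r • b).d = r • b.d := rfl

noncomputable instance : Bracket (Q L) (Q L) :=
  ⟨fun a b => Q.mk ⁅a.p, b.p⁆ 0 (⁅a.p, b.d⁆ + ⁅a.d, b.p⁆ - a.c b.p + b.c a.p)⟩

@[simp] theorem Q.lie_p (a b : Q L) : (⁅a, b⁆ : Q L).p = ⁅a.p, b.p⁆ := rfl
@[simp] theorem Q.lie_c (a b : Q L) : (⁅a, b⁆ : Q L).c = 0 := rfl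
@[simp] theorem Q.lie_d (a b : Q L) : (⁅a, b⁆ : Q L).d =
  ⁅a.p, b.d⁆ + ⁅a.d, b.p⁆ - a.c b.p + b.c a.p := rfl

noncomputable instance : LieRing (Q L) where
  add_lie a b c := by
    apply Q.ext
    · simp
    · simp
    · simp; abel
  lie_add a b c := by
    apply Q.ext
    · simp
    · simp
    · simp; abel
  lie_self a := by
    apply Q.ext
    · simp
    · simp
    · simp only [Q.lie_d, sub_add_cancel, Q.zero_d]
      rw [← lie_skew, neg_add_cancel]
  leibniz_lie a b c := by
    apply Q.ext
    · simp
    · simp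
    · simp only [Q.lie_d, Q.lie_p, Q.lie_c, Q.add_d, LieDerivation.coe_zero, Pi.zero_apply, lie_add,
        lie_sub, add_lie, sub_lie, LieDerivation.apply_lie_eq_add, lie_lie]
      rw [← lie_skew b.p (c.c a.p)]
      abel

noncomputable instance : LieAlgebra ℂ (Q L) where
  lie_smul r a b := by
    apply Q.ext
    · simp
    · simp
    · simp [smul_add, smul_sub]
end Q

/-- Twisted derivations on `FPlus A` from data on generators. -/
theorem exists_tw (c : Fin n → ℤ → LieDerivation ℂ (FPlus A) (FPlus A)) (d : Fin n → ℤ → FPlus A)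
    (h1 : R1 (fun i k => Q.mk (FPlusGen A i k) (c i k) (d i k)))
    (h2 : R2 A (fun i k => Q.mk (FPlusGen A i k) (c i k) (d i k))) :
    ∃ (C : FPlus A →ₗ[ℂ] LieDerivation ℂ (FPlus A) (FPlus A)) (δ : FPlus A →ₗ[ℂ] FPlus A),
      (∀ i k, C (FPlusGen A i k) = c i k) ∧ (∀ i k, δ (FPlusGen A i k) = d i k) ∧
      (∀ x y : FPlus A, C ⁅x, y⁆ = 0) ∧
      (∀ x y : FPlus A, δ ⁅x, y⁆ = ⁅x, δ y⁆ + ⁅δ x, y⁆ - C x y + C y x) := by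
  obtain ⟨f, hf⟩ := exists_Flift A _ h1 h2
  have hp : ∀ x, (f x).p = x := by
    apply F_ind
    · simp
    · intro x y hx hy; simp [hx, hy]
    · intro r x hx; simp [hx]
    · intro x y hx hy; simp [hx, hy]
    · intro i k; simp [hf]
  refine ⟨{ toFun := fun x => (f x).c, map_add' := by simp, map_smul' := by simp },
    { toFun := fun x => (f x).d, map_add' := by simp, map_smul' := by simp }, ?_, ?_, ?_, ?_⟩
  · intro i k; simp [hf]
  · intro i k; simp [hf]
  · intro x y; simp
  · intro x y; simp [hp]

/-- The weighted shift derivations. -/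
theorem exists_D (φ : Fin n → ℂ) (m : ℤ) : ∃ D : LieDerivation ℂ (FPlus A) (FPlus A),
    ∀ i k, D (FPlusGen A i k) = φ i • FPlusGen A i (k + m) := by
  have F1 := F_R1 A
  have h1 : R1 (fun i k => Q.mk (FPlusGen A i k) 0 (φ i • FPlusGen A i (k + m))) := by
    intro i j k l
    apply Q.ext
    · simpa using F1 i j k l
    · simp
    · simp only [Q.lie_d, Q.mk_p, Q.mk_c, Q.mk_d, lie_smul, smul_lie, LieDerivation.coe_zero, Pi.zero_apply]
      rw [F1.sum i j (show k + 1 + (l + m) = k + (l + 1 + m) by ring),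
        F1.sum i j (show k + 1 + m + l = k + m + (l + 1) by ring)]
  have h2 : R2 A (fun i k => Q.mk (FPlusGen A i k) 0 (φ i • FPlusGen A i (k + m))) := by
    apply h1.r2
    intro i j hij l
    have key : ∀ N : ℕ, ((LieAlgebra.ad ℂ (Q (FPlus A)) (Q.mk (FPlusGen A i 0) 0 (φ i • FPlusGen A i (0 + m)))) ^ N)
        (Q.mk (FPlusGen A j l) 0 (φ j • FPlusGen A j (l + m))) =
        Q.mk ((LieAlgebra.ad ℂ (FPlus A) (FPlusGen A i 0) ^ N) (FPlusGen A j l)) 0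
          ((φ j + N * φ i) • (LieAlgebra.ad ℂ (FPlus A) (FPlusGen A i 0) ^ N) (FPlusGen A j (l + m))) := by
      intro N
      induction N with
      | zero => simp
      | succ N ih =>
        rw [pow_succ', Module.End.mul_apply, ih, LieAlgebra.ad_apply]
        apply Q.ext
        · simp [pow_succ']
        · simp
        · simp only [Q.lie_d, Q.mk_p, Q.mk_c, Q.mk_d, lie_smul, smul_lie, LieDerivation.coe_zero, Pi.zero_apply,
            F1.move]
          simp only [zero_add, pow_succ', Module.End.mul_apply, LieAlgebra.ad_apply, sub_zero, add_zero]
          push_cast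
          module
    have e0 := F1.serre A (F_R2 A) i j hij
    simp only [key, e0, smul_zero]
    rfl
  obtain ⟨C, δ, hC, hδ, hC2, hδ2⟩ := exists_tw A _ _ h1 h2
  have hC0 : ∀ x, C x = 0 := by
    apply F_ind
    · simp
    · intro x y hx hy; simp [hx, hy]
    · intro r x hx; simp [hx]
    · intro x y hx hy; exact hC2 x y
    · intro i k; simp [hC]
  refine ⟨{ δ with leibniz' := ?_ }, ?_⟩
  · intro x y
    have := hδ2 x y
    rw [hC0, hC0, ← lie_skew (δ x) y] at this
    simpa [sub_eq_add_neg] using this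
  · intro i k; exact hδ i k
/-- The weighted shift derivation. -/
noncomputable def D (φ : Fin n → ℂ) (m : ℤ) : LieDerivation ℂ (FPlus A) (FPlus A) :=
  Classical.choose (exists_D A φ m)

@[simp] theorem D_gen (φ : Fin n → ℂ) (m : ℤ) (i : Fin n) (k : ℤ) :
    D A φ m (FPlusGen A i k) = φ i • FPlusGen A i (k + m) := Classical.choose_spec (exists_D A φ m) i k

theorem D_comm (φ ψ : Fin n → ℂ) (m : ℤ) (y : FPlus A) :
    D A φ 0 (D A ψ m y) = D A ψ m (D A φ 0 y) := by
  revert y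
  apply F_ind
  · simp
  · intro x y hx hy; simp [hx, hy]
  · intro r x hx; simp [hx]
  · intro x y hx hy
    simp only [LieDerivation.apply_lie_eq_add, map_add, hx, hy]
    abel
  · intro i k; simp [smul_smul, mul_comm]

/-- Row of the Cartan matrix. -/
noncomputable def row (i0 : Fin n) : Fin n → ℂ := fun j => (A i0 j : ℂ)

theorem adD0 (φ : Fin n → ℂ) (i j : Fin n) (l : ℤ) (N : ℕ) :
    D A φ 0 ((LieAlgebra.ad ℂ (FPlus A) (FPlusGen A i 0) ^ N) (FPlusGen A j l)) =
      (φ j + N * φ i) • (LieAlgebra.ad ℂ (FPlus A) (FPlusGen A i 0) ^ N) (FPlusGen A j l) := by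
  induction N with
  | zero => simp
  | succ N ih =>
    rw [pow_succ', Module.End.mul_apply, LieAlgebra.ad_apply, LieDerivation.apply_lie_eq_add, ih, D_gen,
      lie_smul, smul_lie, zero_add]
    push_cast
    module

variable {A} in
theorem exists_δ (hdiag : ∀ i, A i i = 2)
    (hoff : ∀ i j, i ≠ j → A i j ≤ 0)
    (hzero : ∀ i j, A i j = 0 ↔ A j i = 0) (i0 : Fin n) :
    ∃ (C : FPlus A →ₗ[ℂ] LieDerivation ℂ (FPlus A) (FPlus A)) (δ : FPlus A →ₗ[ℂ] FPlus A),
      (∀ i k, C (FPlusGen A i k) = if i = i0 then D A (row A i0) k else 0) ∧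
      (∀ i k, δ (FPlusGen A i k) = 0) ∧
      (∀ x y : FPlus A, C ⁅x, y⁆ = 0) ∧
      (∀ x y : FPlus A, δ ⁅x, y⁆ = ⁅x, δ y⁆ + ⁅δ x, y⁆ - C x y + C y x) := by
  classical
  have F1 := F_R1 A
  have cg : ∀ i j k l, (if i = i0 then D A (row A i0) k else 0) (FPlusGen A j l) =
      if i = i0 then (A i0 j : ℂ) • FPlusGen A j (k + l) else 0 := by
    intro i j k l
    split_ifs
    · simp [row, add_comm]
    · simp
  have h1 : R1 (fun i k => Q.mk (FPlusGen A i k) (if i = i0 then D A (row A i0) k else 0) 0) := by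
    intro i j k l
    apply Q.ext
    · simpa using F1 i j k l
    · simp
    · simp only [Q.lie_d, Q.mk_p, Q.mk_c, Q.mk_d, cg]
      rw [show k + 1 + l = k + (l + 1) by ring, show l + (k + 1) = l + 1 + k by ring]
      simp
  refine exists_tw A _ _ h1 ?_
  apply h1.r2
  intro i j hij l
  have e0 := F1.serre A (F_R2 A) i j hij l
  obtain ⟨M, hM⟩ : ∃ M : ℕ, (1 - A i j).toNat = M + 1 := by
    have := hoff i j hij
    exact ⟨(- A i j).toNat, by omega⟩
  have hM' : (A i j : ℂ) + M = 0 := by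
    have := hoff i j hij
    have h3 : A i j + (M : ℤ) = 0 := by omega
    exact_mod_cast h3
  rw [hM] at e0 ⊢
  by_cases hi : i = i0
  · have hj : j ≠ i0 := fun h => hij (hi.trans h.symm)
    subst hi
    have key : ∀ N : ℕ, ((LieAlgebra.ad ℂ (Q (FPlus A)) (Q.mk (FPlusGen A i 0)
          (if i = i then D A (row A i) 0 else 0) 0)) ^ (N + 1))
        (Q.mk (FPlusGen A j l) (if j = i then D A (row A i) l else 0) 0) =
        Q.mk ((LieAlgebra.ad ℂ (FPlus A) (FPlusGen A i 0) ^ (N + 1)) (FPlusGen A j l)) 0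
          (-((N + 1) * (A i j + N) : ℂ) • (LieAlgebra.ad ℂ (FPlus A) (FPlusGen A i 0) ^ N) (FPlusGen A j l)) := by
      intro N
      induction N with
      | zero =>
        apply Q.ext
        · simp
        · simp
        · simp [hj, row]
      | succ N ih =>
        rw [pow_succ', Module.End.mul_apply, ih, LieAlgebra.ad_apply]
        apply Q.ext
        · rw [pow_succ' _ (N + 1)]; simp
        · simp
        · simp only [Q.lie_d, Q.mk_p, Q.mk_c, Q.mk_d, lie_smul, if_true, adD0, zero_lie, LieDerivation.coe_zero,
            Pi.zero_apply, row, hdiag]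
          simp only [pow_succ', Module.End.mul_apply, LieAlgebra.ad_apply]
          push_cast
          module
    rw [key, e0, hM']
    simp
    rfl
  · by_cases hj : j = i0
    · subst hj
      have key : ∀ N : ℕ, ((LieAlgebra.ad ℂ (Q (FPlus A)) (Q.mk (FPlusGen A i 0)
          (if i = j then D A (row A j) 0 else 0) 0)) ^ (N + 1))
        (Q.mk (FPlusGen A j l) (if j = j then D A (row A j) l else 0) 0) =
        Q.mk ((LieAlgebra.ad ℂ (FPlus A) (FPlusGen A i 0) ^ (N + 1)) (FPlusGen A j l)) 0
          (if N = 0 then (A j i : ℂ) • FPlusGen A i l else 0) := by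
        intro N
        induction N with
        | zero =>
          apply Q.ext
          · simp
          · simp
          · simp [hi, row]
        | succ N ih =>
          rw [pow_succ', Module.End.mul_apply, ih, LieAlgebra.ad_apply]
          apply Q.ext
          · rw [pow_succ' _ (N + 1)]; simp
          · simp
          · by_cases hN : N = 0
            · simp [hi, hN, F1.comm]
            · simp [hi, hN]
      rw [key, e0]
      have : (if M = 0 then (A j i : ℂ) • FPlusGen A i l else 0) = 0 := by
        split_ifs with h
        · subst h
          have h4 : A i j = 0 := by exact_mod_cast (by simpa using hM')
          rw [(hzero i j).1 h4]; simp
        · rfl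
      rw [this]; rfl
    · have key : ∀ N : ℕ, ((LieAlgebra.ad ℂ (Q (FPlus A)) (Q.mk (FPlusGen A i 0)
          (if i = i0 then D A (row A i0) 0 else 0) 0)) ^ N)
        (Q.mk (FPlusGen A j l) (if j = i0 then D A (row A i0) l else 0) 0) =
        Q.mk ((LieAlgebra.ad ℂ (FPlus A) (FPlusGen A i 0) ^ N) (FPlusGen A j l)) 0 0 := by
        intro N
        induction N with
        | zero => simp [hj]
        | succ N ih =>
          rw [pow_succ', Module.End.mul_apply, ih, LieAlgebra.ad_apply]
          apply Q.ext
          · rw [pow_succ' _ N]; simp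
          · simp
          · simp [hi]
      rw [key, e0]; rfl
/-! Weights. -/

/-- Weight spaces. -/
noncomputable def wt (β : Fin n → ℤ) : Submodule ℂ (FPlus A) where
  carrier := {y | ∀ j, D A (Pi.single j 1) 0 y = (β j : ℂ) • y}
  add_mem' := by intro x y hx hy j; simp [hx j, hy j]
  zero_mem' := by intro j; simp
  smul_mem' := by intro r x hx j; simp [hx j, smul_smul, mul_comm]

theorem mem_wt {β : Fin n → ℤ} {y : FPlus A} :
    y ∈ wt A β ↔ ∀ j, D A (Pi.single j 1) 0 y = (β j : ℂ) • y := Iff.rfl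

theorem gen_wt (i : Fin n) (k : ℤ) : FPlusGen A i k ∈ wt A (Pi.single i 1) := by
  intro j
  by_cases h : i = j
  · subst h; simp
  · simp [Pi.single_apply, h, Ne.symm h]

theorem lie_wt {β γ : Fin n → ℤ} {x y : FPlus A} (hx : x ∈ wt A β) (hy : y ∈ wt A γ) :
    ⁅x, y⁆ ∈ wt A (β + γ) := by
  intro j
  rw [LieDerivation.apply_lie_eq_add, hx j, hy j, lie_smul, smul_lie, Pi.add_apply]
  push_cast
  module

theorem D_sum (φ : Fin n → ℂ) (y : FPlus A) :
    D A φ 0 y = ∑ j, φ j • D A (Pi.single j 1) 0 y := by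
  revert y
  apply F_ind
  · simp
  · intro x y hx hy; simp [hx, hy, Finset.sum_add_distrib]
  · intro r x hx; simp only [map_smul, hx, Finset.smul_sum]
    refine Finset.sum_congr rfl fun j _ => ?_
    rw [smul_comm]
  · intro x y hx hy
    simp only [LieDerivation.apply_lie_eq_add, hx, hy, smul_add, Finset.sum_add_distrib, LieSubmodule.coe_toSubmodule]
    rw [lie_sum, sum_lie]
    simp only [lie_smul, smul_lie]
  · intro i k
    simp only [D_gen, smul_smul]
    rw [← Finset.sum_smul]
    simp [Pi.single_apply]

theorem D_wt (φ : Fin n → ℂ) {β : Fin n → ℤ} {y : FPlus A} (hy : y ∈ wt A β) :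
    D A φ 0 y = (∑ j, φ j * β j) • y := by
  rw [D_sum, Finset.sum_smul]
  refine Finset.sum_congr rfl fun j _ => ?_
  rw [hy j, smul_smul]

/-- Positive weights. -/
def Pos (β : Fin n → ℤ) : Prop := 0 ≤ β ∧ β ≠ 0

theorem iSup_wt (y : FPlus A) : y ∈ ⨆ β : {β : Fin n → ℤ // Pos β}, wt A β.1 := by
  revert y
  apply F_ind
  · exact Submodule.zero_mem _
  · intro x y hx hy; exact Submodule.add_mem _ hx hy
  · intro r x hx; exact Submodule.smul_mem _ _ hx
  · intro x y hx hy
    induction hx using Submodule.iSup_induction' with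
    | mem β x hx =>
      induction hy using Submodule.iSup_induction' with
      | mem γ y hy =>
        refine Submodule.mem_iSup_of_mem ⟨β.1 + γ.1, add_nonneg β.2.1 γ.2.1, fun h => β.2.2 ?_⟩ (lie_wt A hx hy)
        have h1 : β.1 ≤ 0 := by
          rw [← h]; exact le_add_of_nonneg_right γ.2.1
        exact le_antisymm h1 β.2.1
      | zero => simp
      | add y z _ _ hy hz => rw [lie_add]; exact Submodule.add_mem _ hy hz
    | zero => simp
    | add x z _ _ hx hz => rw [add_lie]; exact Submodule.add_mem _ hx hz
  · intro i k
    refine Submodule.mem_iSup_of_mem ⟨Pi.single i 1, ?_, ?_⟩ (gen_wt A i k)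
    · intro j; by_cases h : j = i
      · subst h; simp
      · simp [h]
    · intro h; simpa using congrFun h i

theorem comp_mem (K : Submodule ℂ (FPlus A)) (hK : ∀ j, ∀ y ∈ K, D A (Pi.single j 1) 0 y ∈ K)
    (S : Finset (Fin n → ℤ)) : ∀ (v : (Fin n → ℤ) → FPlus A), (∀ β ∈ S, v β ∈ wt A β) →
    ∑ β ∈ S, v β ∈ K → ∀ β ∈ S, v β ∈ K := by
  classical
  induction S using Finset.induction_on with
  | empty => simp
  | insert γ S hγ ih =>
    intro v hv hsum
    have h1 : ∀ β ∈ S, v β ∈ K := by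
      intro β0 hβ0
      obtain ⟨j, hj⟩ : ∃ j, β0 j ≠ γ j := by
        by_contra! h
        exact hγ ((funext h : β0 = γ) ▸ hβ0)
      have h2 := ih (fun β => ((β j : ℂ) - γ j) • v β)
        (fun β hβ => Submodule.smul_mem _ _ (hv β (Finset.mem_insert_of_mem hβ))) (by
          have h3 := Submodule.sub_mem K (hK j _ hsum) (Submodule.smul_mem K (γ j : ℂ) hsum)
          convert h3 using 1
          rw [map_sum, Finset.smul_sum, ← Finset.sum_sub_distrib, Finset.sum_insert hγ,
            hv γ (Finset.mem_insert_self _ _) j, sub_self, zero_add]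
          refine Finset.sum_congr rfl fun β hβ => ?_
          rw [hv β (Finset.mem_insert_of_mem hβ) j, sub_smul]) β0 hβ0
      refine (Submodule.smul_mem_iff K ?_).1 h2
      rw [sub_ne_zero]; exact_mod_cast hj
    intro β hβ
    rcases Finset.mem_insert.1 hβ with rfl | h
    · rw [Finset.sum_insert hγ] at hsum
      exact (Submodule.add_mem_iff_left K (Submodule.sum_mem K h1)).1 hsum
    · exact h1 β h

theorem exists_decomp (y : FPlus A) : ∃ (S : Finset (Fin n → ℤ)) (v : (Fin n → ℤ) → FPlus A),
    (∀ β ∈ S, Pos β) ∧ (∀ β ∈ S, v β ∈ wt A β) ∧ ∑ β ∈ S, v β = y := by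
  classical
  obtain ⟨f, hf, hs⟩ := (Submodule.mem_iSup_iff_exists_finsupp _ _).1 (iSup_wt A y)
  refine ⟨f.support.map (Function.Embedding.subtype _), fun β => if h : Pos β then f ⟨β, h⟩ else 0, ?_, ?_, ?_⟩
  · intro β hβ
    obtain ⟨b, _, rfl⟩ := Finset.mem_map.1 hβ
    exact b.2
  · intro β hβ
    obtain ⟨b, _, rfl⟩ := Finset.mem_map.1 hβ
    simpa [b.2] using hf b
  · rw [Finset.sum_map, ← hs]
    refine Finset.sum_congr rfl fun b _ => ?_
    simp [b.2]

theorem wt_zero {β : Fin n → ℤ} (hβ : ¬ Pos β) {y : FPlus A} (hy : y ∈ wt A β) : y = 0 := by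
  classical
  obtain ⟨S, v, hS, hv, rfl⟩ := exists_decomp A y
  have hn : β ∉ S := fun h => hβ (hS β h)
  have := comp_mem A ⊥ (by simp) (insert β S) (fun γ => if γ = β then - ∑ β ∈ S, v β else v γ) (by
    intro γ hγ
    by_cases h : γ = β
    · subst h; simpa using hy
    · simpa [h] using hv γ (Finset.mem_of_mem_insert_of_ne hγ h)) (by
    rw [Finset.sum_insert hn]
    have : ∑ γ ∈ S, (if γ = β then - ∑ β ∈ S, v β else v γ) = ∑ γ ∈ S, v γ :=
      Finset.sum_congr rfl fun γ hγ => by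
        rw [if_neg]; rintro rfl; exact hn hγ
    rw [this]; simp) β (Finset.mem_insert_self _ _)
  simpa using this

/-- Evaluation endomorphisms. -/
theorem exists_ev (a : ℂˣ) : ∃ f : FPlus A →ₗ⁅ℂ⁆ FPlus A,
    ∀ i k, f (FPlusGen A i k) = ((a ^ k : ℂˣ) : ℂ) • FPlusGen A i 0 := by
  have h1 : R1 (fun i k => ((a ^ k : ℂˣ) : ℂ) • FPlusGen A i 0) := by
    intro i j k l
    simp only [lie_smul, smul_lie, smul_smul]
    congr 1
    rw [zpow_add, zpow_add]
    push_cast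
    ring
  refine exists_Flift A _ h1 (h1.r2 A ?_)
  intro i j hij l
  simp only [zpow_zero, Units.val_one, one_smul, map_smul]
  rw [(F_R1 A).serre A (F_R2 A) i j hij, smul_zero]

/-- Evaluation endomorphisms. -/
noncomputable def ev (a : ℂˣ) : FPlus A →ₗ⁅ℂ⁆ FPlus A := Classical.choose (exists_ev A a)

@[simp] theorem ev_gen (a : ℂˣ) (i : Fin n) (k : ℤ) :
    ev A a (FPlusGen A i k) = ((a ^ k : ℂˣ) : ℂ) • FPlusGen A i 0 := Classical.choose_spec (exists_ev A a) i k

theorem ev_D (a : ℂˣ) (φ : Fin n → ℂ) (m : ℤ) (y : FPlus A) :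
    ev A a (D A φ m y) = ((a ^ m : ℂˣ) : ℂ) • D A φ 0 (ev A a y) := by
  revert y
  apply F_ind
  · simp
  · intro x y hx hy; simp [hx, hy]
  · intro r x hx; simp [hx]; rw [smul_comm]
  · intro x y hx hy
    simp only [LieDerivation.apply_lie_eq_add, map_add, LieHom.map_lie, hx, hy, lie_smul, smul_lie, smul_add]
  · intro i k
    simp only [D_gen, ev_gen, map_smul, smul_smul, zpow_add, add_zero]
    congr 1
    push_cast
    ring

/-- The intersection of the kernels of the evaluations. -/
noncomputable def K : Submodule ℂ (FPlus A) where
  carrier := {y | ∀ a, ev A a y = 0}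
  add_mem' := by intro x y hx hy a; simp [hx a, hy a]
  zero_mem' := by intro a; simp
  smul_mem' := by intro r x hx a; simp [hx a]

theorem K_D (j : Fin n) (y : FPlus A) (hy : y ∈ K A) : D A (Pi.single j 1) 0 y ∈ K A := by
  intro a; rw [ev_D, hy a]; simp

/-- The additive functional picking out the `i0`-part. -/
theorem exists_chi (hoff : ∀ i j, i ≠ j → A i j ≤ 0) (i0 : Fin n) : ∃ f : FPlus A →ₗ[ℂ] ℂ,
    (∀ i k, f (FPlusGen A i k) = if i = i0 then 1 else 0) ∧ ∀ x y : FPlus A, f ⁅x, y⁆ = 0 := by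
  letI : LieRing ℂ := LieRing.ofAssociativeRing
  have hl : ∀ x y : ℂ, ⁅x, y⁆ = 0 := fun x y => by
    rw [LieRing.of_associative_ring_bracket, mul_comm, sub_self]
  have h1 : R1 (fun (i : Fin n) (_ : ℤ) => if i = i0 then (1 : ℂ) else 0) := by
    intro i j k l
    simp only [hl]
  suffices h : R2 A (fun (i : Fin n) (_ : ℤ) => if i = i0 then (1 : ℂ) else 0) by
    obtain ⟨f, hf⟩ := exists_Flift A _ h1 h
    exact ⟨f, hf, fun x y => (f.map_lie x y).trans (hl _ _)⟩
  refine h1.r2 A ?_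
  intro i j hij l
  obtain ⟨M, hM⟩ : ∃ M : ℕ, (1 - A i j).toNat = M + 1 := by
    have := hoff i j hij
    exact ⟨(- A i j).toNat, by omega⟩
  rw [hM, pow_succ', Module.End.mul_apply, LieAlgebra.ad_apply, hl]

theorem laurent_zero (h : ℤ →₀ ℂ) (hh : ∀ a : ℂˣ, h.sum (fun k c => c * ((a ^ k : ℂˣ) : ℂ)) = 0) : h = 0 := by
  have li := linearIndependent_monoidHom ℂˣ ℂ
  let e : ℤ → (ℂˣ →* ℂ) := fun k => (Units.coeHom ℂ).comp (zpowGroupHom k)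
  have he : Function.Injective e := by
    intro k l hkl
    have h2 := DFunLike.congr_fun hkl (Units.mk0 (2 : ℂ) two_ne_zero)
    have h3 : (2 : ℂ) ^ k = 2 ^ l := by simpa [e] using h2
    have h4 : (2 : ℝ) ^ k = 2 ^ l := by apply Complex.ofReal_injective; push_cast; exact h3
    exact zpow_right_injective₀ (by norm_num) (by norm_num) h4
  have li2 := li.comp e he
  rw [linearIndependent_iff] at li2
  apply li2
  ext a
  have := hh a
  simp only [Finsupp.linearCombination_apply, Finsupp.sum, Finset.sum_apply, Pi.smul_apply] at this ⊢
  simpa [e] using this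
theorem sl2 {V : Type*} [AddCommGroup V] [Module ℂ V] (e f : V →ₗ[ℂ] V) (v : V) (lam : ℤ) (hlam : 0 < lam)
    (hf : f v = 0)
    (hef : ∀ m : ℕ, f ((e ^ (m + 1)) v) = e (f ((e ^ m) v)) - ((lam : ℂ) + 2 * m) • (e ^ m) v)
    (N : ℕ) (hN : (e ^ N) v = 0) : v = 0 := by
  have key : ∀ m : ℕ, f ((e ^ (m + 1)) v) = -((m + 1) * ((lam : ℂ) + m)) • (e ^ m) v := by
    intro m
    induction m with
    | zero => rw [hef]; simp [hf]
    | succ m ih =>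
      rw [hef, ih, map_smul, ← Module.End.mul_apply, ← pow_succ']
      push_cast
      module
  induction N with
  | zero => simpa using hN
  | succ N ih =>
    apply ih
    have h := key N
    rw [hN, map_zero] at h
    have h2 : -((N + 1) * ((lam : ℂ) + N)) ≠ 0 := by
      have h3 : (((N : ℤ) + 1) * (lam + N)) ≠ 0 := by positivity
      rw [neg_ne_zero]
      exact_mod_cast h3
    exact (smul_eq_zero.1 h.symm).resolve_left h2

theorem nilp (hoff : ∀ i j, i ≠ j → A i j ≤ 0) (i : Fin n) (v : FPlus A) :
    ∃ N : ℕ, (LieAlgebra.ad ℂ (FPlus A) (FPlusGen A i 0) ^ N) v = 0 := by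
  rw [← LieSubalgebra.mem_engel_iff]
  apply F_top
  intro j k
  rw [LieSubalgebra.mem_engel_iff]
  by_cases h : i = j
  · subst h
    exact ⟨1, by simpa using (F_R1 A).comm i 0 k⟩
  · exact ⟨_, (F_R1 A).serre A (F_R2 A) i j h k⟩

variable {A} in
/-- One step of the descent. -/
theorem step (hdiag : ∀ i, A i i = 2)
    (hoff : ∀ i j, i ≠ j → A i j ≤ 0)
    (hzero : ∀ i j, A i j = 0 ↔ A j i = 0) (i0 : Fin n) (β : Fin n → ℤ)
    (hpos : 0 < ∑ j, A i0 j * β j) (v : FPlus A) (hv : v ∈ wt A β) (hvK : v ∈ K A)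
    (IH : ∀ w ∈ wt A (β - Pi.single i0 1), w ∈ K A → w = 0) : v = 0 := by
  classical
  obtain ⟨C, δ, hC, hδ, hC2, hδ2⟩ := exists_δ hdiag hoff hzero i0
  obtain ⟨χ, hχ, hχ2⟩ := exists_chi A hoff i0
  -- C vanishes on K
  have hCform : ∀ y : FPlus A, ∃ h : ℤ →₀ ℂ, C y = h.sum (fun k c => c • D A (row A i0) k) ∧
      ∀ a : ℂˣ, χ (ev A a y) = h.sum (fun k c => c * ((a ^ k : ℂˣ) : ℂ)) := by
    apply F_ind
    · exact ⟨0, by simp, by simp⟩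
    · rintro x y ⟨h, h1, h2⟩ ⟨h', h1', h2'⟩
      refine ⟨h + h', ?_, fun a => ?_⟩
      · rw [map_add, h1, h1', Finsupp.sum_add_index' (by simp) (by intro k a b; rw [add_smul])]
      · rw [map_add, map_add, h2, h2', Finsupp.sum_add_index' (by simp) (by intro k a b; rw [add_mul])]
    · rintro r x ⟨h, h1, h2⟩
      refine ⟨r • h, ?_, fun a => ?_⟩
      · rw [map_smul, h1, Finsupp.sum_smul_index (by simp), Finsupp.smul_sum]
        simp only [smul_smul]
      · rw [map_smul, map_smul, h2, Finsupp.sum_smul_index (by simp), Finsupp.smul_sum]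
        simp only [smul_eq_mul, mul_assoc]
    · intro x y _ _
      exact ⟨0, by simp [hC2], by simp [hχ2]⟩
    · intro i k
      by_cases h : i = i0
      · exact ⟨Finsupp.single k 1, by simp [hC, h], by simp [hχ, h]⟩
      · exact ⟨0, by simp [hC, h], by simp [hχ, h]⟩
  have hCv : C v = 0 := by
    obtain ⟨h, h1, h2⟩ := hCform v
    have : h = 0 := laurent_zero h (fun a => by rw [← h2, hvK a, map_zero])
    rw [h1, this]; simp
  have evC : ∀ (a : ℂˣ) (y x : FPlus A), ev A a (C x y) = C (ev A a x) (ev A a y) := by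
    intro a y
    apply F_ind
    · simp
    · intro x z hx hz; simp [hx, hz]
    · intro r x hx; simp [hx]
    · intro x z _ _; simp [hC2]
    · intro i k
      by_cases h : i = i0
      · simp [hC, h, ev_D]
      · simp [hC, h]
  have evδ : ∀ (a : ℂˣ) (y : FPlus A), ev A a (δ y) = δ (ev A a y) := by
    intro a
    apply F_ind
    · simp
    · intro x z hx hz; simp [hx, hz]
    · intro r x hx; simp [hx]
    · intro x z hx hz; simp [hδ2, hx, hz, evC]
    · intro i k; simp [hδ]
  have WC : ∀ (j : Fin n) (y x : FPlus A), D A (Pi.single j 1) 0 (C x y) = C x (D A (Pi.single j 1) 0 y) := by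
    intro j y
    apply F_ind
    · simp
    · intro x z hx hz; simp [hx, hz]
    · intro r x hx; simp [hx]
    · intro x z _ _; simp [hC2]
    · intro i k
      by_cases h : i = i0
      · simp [hC, h, D_comm]
      · simp [hC, h]
  have CW : ∀ (j : Fin n) (x : FPlus A), C (D A (Pi.single j 1) 0 x) = (if j = i0 then (1 : ℂ) else 0) • C x := by
    intro j
    apply F_ind
    · simp
    · intro x z hx hz; simp only [map_add, hx, hz, smul_add]
    · intro r x hx; simp only [map_smul, hx]; rw [smul_comm]
    · intro x z _ _; simp [LieDerivation.apply_lie_eq_add, hC2]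
    · intro i k
      by_cases h : i = i0
      · subst h
        by_cases h' : j = i
        · subst h'; simp
        · simp [h', Ne.symm h']
      · simp [hC, h]
  have Wδ : ∀ (j : Fin n) (y : FPlus A), D A (Pi.single j 1) 0 (δ y) =
      δ (D A (Pi.single j 1) 0 y) - (if j = i0 then (1 : ℂ) else 0) • δ y := by
    intro j
    apply F_ind
    · simp
    · intro x z hx hz; simp only [map_add, hx, hz, smul_add]; abel
    · intro r x hx; simp only [map_smul, hx, smul_sub]; rw [smul_comm]
    · intro x z hx hz
      simp only [LieDerivation.apply_lie_eq_add, hδ2, map_add, map_sub, hx, hz, WC, CW, lie_sub, sub_lie,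
        LieDerivation.smul_apply, lie_smul, smul_lie]
      module
    · intro i k; simp [hδ]
  have hδv : δ v = 0 := by
    apply IH
    · intro j
      rw [Wδ, hv j, map_smul, ← sub_smul]
      congr 1
      simp [Pi.single_apply]
    · intro a
      rw [evδ, hvK a, map_zero]
  have hCe : ∀ m : ℕ, C ((LieAlgebra.ad ℂ (FPlus A) (FPlusGen A i0 0) ^ m) v) = 0 := by
    intro m
    cases m with
    | zero => simpa using hCv
    | succ m => rw [pow_succ', Module.End.mul_apply, LieAlgebra.ad_apply, hC2]
  have hDe : ∀ m : ℕ, D A (row A i0) 0 ((LieAlgebra.ad ℂ (FPlus A) (FPlusGen A i0 0) ^ m) v) =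
      (((∑ j, A i0 j * β j : ℤ) : ℂ) + 2 * m) • (LieAlgebra.ad ℂ (FPlus A) (FPlusGen A i0 0) ^ m) v := by
    intro m
    induction m with
    | zero => simp [D_wt A _ hv, row]
    | succ m ih =>
      rw [pow_succ', Module.End.mul_apply, LieAlgebra.ad_apply, LieDerivation.apply_lie_eq_add, ih, D_gen,
        lie_smul, smul_lie, zero_add, row, hdiag]
      push_cast
      module
  obtain ⟨N, hN⟩ := nilp A hoff i0 v
  refine sl2 (LieAlgebra.ad ℂ (FPlus A) (FPlusGen A i0 0)) δ v _ hpos hδv ?_ N hN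
  intro m
  rw [pow_succ', Module.End.mul_apply, LieAlgebra.ad_apply, hδ2, hCe, hδ, hC, if_pos rfl, hDe]
  simp

variable {A} in
theorem exists_pos (d : Fin n → ℤ) (hd : ∀ i, 0 < d i)
    (hfin : Matrix.PosDef (fun i j : Fin n => ((d i * A i j : ℤ) : ℝ)))
    (β : Fin n → ℤ) (hβ : Pos β) : ∃ i, 0 < ∑ j, A i j * β j := by
  by_contra! h
  have hx : (fun i => (β i : ℝ)) ≠ 0 := by
    intro h0
    apply hβ.2
    funext i
    simpa using congrFun h0 i
  have h1 := hfin.dotProduct_mulVec_pos hx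
  have h2 : (star (fun i => (β i : ℝ))) ⬝ᵥ (Matrix.mulVec (fun i j : Fin n => ((d i * A i j : ℤ) : ℝ)) (fun i => (β i : ℝ))) =
      ((∑ i, (β i * d i) * ∑ j, A i j * β j : ℤ) : ℝ) := by
    simp only [dotProduct, Matrix.mulVec, Pi.star_apply, star_trivial]
    push_cast
    refine Finset.sum_congr rfl fun i _ => ?_
    rw [Finset.mul_sum, Finset.mul_sum]
    refine Finset.sum_congr rfl fun j _ => ?_
    ring
  rw [h2] at h1
  have h3 : 0 < ∑ i, (β i * d i) * ∑ j, A i j * β j := by exact_mod_cast h1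
  refine absurd h3 (not_lt.2 (Finset.sum_nonpos fun i _ => ?_))
  exact mul_nonpos_of_nonneg_of_nonpos (mul_nonneg (hβ.1 i) (hd i).le) (h i)

variable {A} in
theorem K_zero (hdiag : ∀ i, A i i = 2)
    (hoff : ∀ i j, i ≠ j → A i j ≤ 0)
    (hzero : ∀ i j, A i j = 0 ↔ A j i = 0) (d : Fin n → ℤ) (hd : ∀ i, 0 < d i)
    (hfin : Matrix.PosDef (fun i j : Fin n => ((d i * A i j : ℤ) : ℝ)))
    (y : FPlus A) (hy : y ∈ K A) : y = 0 := by
  have main : ∀ (N : ℕ) (β : Fin n → ℤ), ∑ i, β i ≤ N → ∀ v ∈ wt A β, v ∈ K A → v = 0 := by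
    intro N
    induction N with
    | zero =>
      intro β hN v hv hvK
      refine wt_zero A (fun hβ => hβ.2 ?_) hv
      have h0 : ∑ i, β i = 0 := le_antisymm (by simpa using hN) (Finset.sum_nonneg fun i _ => hβ.1 i)
      funext i
      exact (Finset.sum_eq_zero_iff_of_nonneg (fun i _ => hβ.1 i)).1 h0 i (Finset.mem_univ i)
    | succ N ih =>
      intro β hN v hv hvK
      by_cases hβ : Pos β
      · obtain ⟨i, hi⟩ := exists_pos d hd hfin β hβ
        refine step hdiag hoff hzero i β hi v hv hvK (ih _ ?_)
        simp only [Pi.sub_apply, Finset.sum_sub_distrib, Finset.sum_pi_single', Finset.mem_univ, if_true]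
        push_cast at hN
        linarith
      · exact wt_zero A hβ hv
  obtain ⟨S, v, hS, hv, rfl⟩ := exists_decomp A y
  refine Finset.sum_eq_zero fun β hβ => ?_
  exact main (∑ i, β i).toNat β (Int.self_le_toNat _) _ (hv β hβ) (comp_mem A (K A) (K_D A) S v hv hy β hβ)

/-! The loop algebra. -/
section Loop
variable {L : Type*} [LieRing L] [LieAlgebra ℂ L]

theorem loop_lie (k l : ℤ) (x y : L) : ⁅loopOf L k x, loopOf L l y⁆ = loopOf L (k + l) ⁅x, y⁆ := by
  have h : ⁅(LaurentPolynomial.T k : LaurentPolynomial ℂ) ⊗ₜ[ℂ] x, (LaurentPolynomial.T l : LaurentPolynomial ℂ) ⊗ₜ[ℂ] y⁆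
      = (LaurentPolynomial.T (k + l) : LaurentPolynomial ℂ) ⊗ₜ[ℂ] ⁅x, y⁆ := by
    rw [LieAlgebra.ExtendScalars.bracket_tmul, LaurentPolynomial.T_add]
  exact h

theorem loop_add (k : ℤ) (x y : L) : loopOf L k (x + y) = loopOf L k x + loopOf L k y := by
  have h := TensorProduct.tmul_add (R := ℂ) (LaurentPolynomial.T k : LaurentPolynomial ℂ) x y
  exact h

theorem algMap_smul (r : ℂ) (z : LaurentPolynomial ℂ ⊗[ℂ] L) :
    (algebraMap ℂ (LaurentPolynomial ℂ) r) • z = r • z := algebraMap_smul _ r z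

theorem loop_smul (k : ℤ) (r : ℂ) (x : L) : loopOf L k (r • x) = r • loopOf L k x := by
  have h := TensorProduct.tmul_smul (R := ℂ) r (LaurentPolynomial.T k : LaurentPolynomial ℂ) x
  rw [← algMap_smul] at h
  exact h

/-- `loopOf` as a linear map. -/
noncomputable def loopL (k : ℤ) : L →ₗ[ℂ] LoopAlg L where
  toFun := loopOf L k
  map_add' := loop_add k
  map_smul' := loop_smul k

theorem loop_ad (k : ℤ) (x y : L) (N : ℕ) :
    (LieAlgebra.ad ℂ (LoopAlg L) (loopOf L 0 x) ^ N) (loopOf L k y) =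
      loopOf L k ((LieAlgebra.ad ℂ L x ^ N) y) := by
  induction N with
  | zero => rfl
  | succ N ih =>
    rw [pow_succ', Module.End.mul_apply, ih, LieAlgebra.ad_apply, loop_lie, zero_add, pow_succ',
      Module.End.mul_apply, LieAlgebra.ad_apply]

theorem loop_span (S : Submodule ℂ (LoopAlg L)) (h : ∀ k x, loopOf L k x ∈ S) (z : LoopAlg L) : z ∈ S := by
  have key : ∀ z : LaurentPolynomial ℂ ⊗[ℂ] L, (show LoopAlg L from z) ∈ S := by
    intro z
    induction z using TensorProduct.induction_on with
    | zero => exact S.zero_mem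
    | add a b ha hb => exact S.add_mem ha hb
    | tmul p x =>
      induction p using LaurentPolynomial.induction_on' with
      | add p q hp hq =>
        have := S.add_mem hp hq
        rw [TensorProduct.add_tmul]
        exact this
      | C_mul_T k a =>
        have h2 : (LaurentPolynomial.C a * LaurentPolynomial.T k : LaurentPolynomial ℂ) ⊗ₜ[ℂ] x =
          (LaurentPolynomial.T k : LaurentPolynomial ℂ) ⊗ₜ[ℂ] (a • x) := by
          rw [← LaurentPolynomial.smul_eq_C_mul, TensorProduct.smul_tmul]
        rw [h2]
        exact h k (a • x)
  exact key z

end Loop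

/-- Evaluation of Laurent polynomials as a linear map. -/
noncomputable def lev (a : ℂˣ) : LaurentPolynomial ℂ →ₗ[ℂ] ℂ where
  toFun := LaurentPolynomial.eval₂ (RingHom.id ℂ) a
  map_add' := map_add _
  map_smul' := fun r p => by
    rw [LaurentPolynomial.smul_eq_C_mul, map_mul, LaurentPolynomial.eval₂_C]
    rfl

theorem exists_Ev {L M : Type*} [LieRing L] [LieAlgebra ℂ L] [LieRing M] [LieAlgebra ℂ M]
    (f : L →ₗ⁅ℂ⁆ M) (a : ℂˣ) : ∃ E : LoopAlg L →ₗ[ℂ] M,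
      (∀ k x, E (loopOf L k x) = ((a ^ k : ℂˣ) : ℂ) • f x) ∧ ∀ u v, E ⁅u, v⁆ = ⁅E u, E v⁆ := by
  let E0 : LaurentPolynomial ℂ ⊗[ℂ] L →ₗ[ℂ] M :=
    TensorProduct.lift ((LinearMap.lsmul ℂ M).flip.compl₁₂ (f : L →ₗ[ℂ] M) (lev a)).flip
  have hE0 : ∀ p x, E0 (p ⊗ₜ x) = lev a p • f x := fun p x => by simp [E0]
  let E : LoopAlg L →ₗ[ℂ] M :=
    { toFun := fun z => E0 z
      map_add' := fun x y => E0.map_add x y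
      map_smul' := fun r x => by
        have h := E0.map_smul r (show LaurentPolynomial ℂ ⊗[ℂ] L from x)
        rw [← algMap_smul (L := L) r (show LaurentPolynomial ℂ ⊗[ℂ] L from x)] at h
        exact h }
  have hE : ∀ k x, E (loopOf L k x) = ((a ^ k : ℂˣ) : ℂ) • f x := by
    intro k x
    refine (hE0 _ _).trans ?_
    congr 1
    exact LaurentPolynomial.eval₂_T _ _ _
  refine ⟨E, hE, ?_⟩
  intro u v
  let S1 : LoopAlg L → Submodule ℂ (LoopAlg L) := fun v =>
    { carrier := {u | E ⁅u, v⁆ = ⁅E u, E v⁆}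
      zero_mem' := by simp
      add_mem' := fun {x y} hx hy => by
        simp only [Set.mem_ofPred_eq] at *
        rw [add_lie, map_add, map_add, add_lie, hx, hy]
      smul_mem' := fun c x hx => by
        simp only [Set.mem_ofPred_eq] at *
        rw [smul_lie, map_smul, map_smul, smul_lie, hx] }
  let S2 : LoopAlg L → Submodule ℂ (LoopAlg L) := fun u =>
    { carrier := {v | E ⁅u, v⁆ = ⁅E u, E v⁆}
      zero_mem' := by simp
      add_mem' := fun {x y} hx hy => by
        simp only [Set.mem_ofPred_eq] at *
        rw [lie_add, map_add, map_add, lie_add, hx, hy]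
      smul_mem' := fun c x hx => by
        simp only [Set.mem_ofPred_eq] at *
        rw [lie_smul, map_smul, map_smul, lie_smul, hx] }
  refine loop_span (S1 v) (fun k x => ?_) u
  refine loop_span (S2 (loopOf L k x)) (fun l y => ?_) v
  change E ⁅_, _⁆ = ⁅_, _⁆
  rw [loop_lie, hE, hE, hE, LieHom.map_lie, smul_lie, lie_smul, smul_smul, zpow_add, Units.val_mul]

theorem exists_pi : ∃ f : FPlus A →ₗ⁅ℂ⁆ LoopAlg (nPlus A),
    ∀ i k, f (FPlusGen A i k) = loopOf (nPlus A) k (nPlusGen A i) := by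
  have h1 : R1 (fun (i : Fin n) k => loopOf (nPlus A) k (nPlusGen A i)) := by
    intro i j k l
    simp only
    rw [loop_lie, loop_lie, add_right_comm, add_assoc]
  refine exists_Flift A _ h1 (h1.r2 A ?_)
  intro i j hij l
  rw [loop_ad, N_serre A i j hij]
  exact (loopL l).map_zero

theorem pi_surj (f : FPlus A →ₗ⁅ℂ⁆ LoopAlg (nPlus A))
    (hf : ∀ i k, f (FPlusGen A i k) = loopOf (nPlus A) k (nPlusGen A i)) : Function.Surjective f := by
  intro z
  suffices h : z ∈ f.range.toSubmodule by
    obtain ⟨y, hy⟩ := (LieHom.mem_range f z).1 h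
    exact ⟨y, hy⟩
  refine loop_span _ (fun k x => ?_) z
  let S : LieSubalgebra ℂ (nPlus A) :=
    { carrier := {x | ∀ k, loopOf (nPlus A) k x ∈ f.range}
      zero_mem' := fun k => by
        have := (loopL (L := nPlus A) k).map_zero
        change loopOf (nPlus A) k 0 = 0 at this
        rw [this]
        exact f.range.zero_mem
      add_mem' := fun {x y} hx hy k => by
        rw [loop_add]
        exact f.range.add_mem (hx k) (hy k)
      smul_mem' := fun c x hx k => by
        rw [loop_smul]
        exact f.range.smul_mem c (hx k)
      lie_mem' := fun {x y} hx hy k => by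
        have := f.range.lie_mem (hx k) (hy 0)
        rw [loop_lie, add_zero] at this
        exact this }
  have : x ∈ S := N_top A S (fun i k => (LieHom.mem_range f _).2 ⟨_, hf i k⟩) x
  exact this k

theorem pi_ker (f : FPlus A →ₗ⁅ℂ⁆ LoopAlg (nPlus A))
    (hf : ∀ i k, f (FPlusGen A i k) = loopOf (nPlus A) k (nPlusGen A i)) (v : FPlus A) (hv : f v = 0) :
    v ∈ K A := by
  obtain ⟨io, hio⟩ := exists_Nlift A (fun i => FPlusGen A i 0)
    (fun i j hij => (F_R1 A).serre A (F_R2 A) i j hij 0)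
  intro a
  obtain ⟨E, hE, hE2⟩ := exists_Ev io a
  have key : ∀ y, E (f y) = ev A a y := by
    apply F_ind
    · simp
    · intro x y hx hy
      simp only [map_add, hx, hy]
    · intro c x hx
      simp only [map_smul, hx]
    · intro x y hx hy
      rw [LieHom.map_lie, LieHom.map_lie, hE2, hx, hy]
    · intro i k
      rw [hf, hE, hio, ev_gen]
  rw [← key, hv, map_zero]

end LoopPf

/-- Let `(a_{ij})` be a Cartan matrix of finite type (generalized Cartan
matrix with positive definite symmetrization) and let `𝔫₊` be the positive nilpotent
subalgebra of the corresponding semisimple Lie algebra, with generators `ē_i`.  Then the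
assignment `x̃_i[k] ↦ ē_i ⊗ tᵏ` defines a Lie algebra isomorphism
`F̃₊ ≅ L𝔫₊ = 𝔫₊ ⊗ ℂ[t,t⁻¹]`. -/
theorem stmt10 (A : Matrix (Fin n) (Fin n) ℤ)
    (hdiag : ∀ i, A i i = 2)
    (hoff : ∀ i j, i ≠ j → A i j ≤ 0)
    (hzero : ∀ i j, A i j = 0 ↔ A j i = 0)
    (d : Fin n → ℤ) (hd : ∀ i, 0 < d i)
    (hsymm : ∀ i j, d i * A i j = d j * A j i)
    (hfin : Matrix.PosDef (fun i j : Fin n => ((d i * A i j : ℤ) : ℝ))) :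
    ∃ e : FPlus A ≃ₗ⁅ℂ⁆ LoopAlg (nPlus A),
      ∀ (i : Fin n) (k : ℤ), e (FPlusGen A i k) = loopOf (nPlus A) k (nPlusGen A i) := by
  obtain ⟨f, hf⟩ := LoopPf.exists_pi A
  have hinj : Function.Injective f := by
    intro x y hxy
    have h : f (x - y) = 0 := by rw [map_sub, hxy, sub_self]
    exact sub_eq_zero.1
      (LoopPf.K_zero hdiag hoff hzero d hd hfin _ (LoopPf.pi_ker A f hf _ h))
  exact ⟨LieEquiv.ofBijective f ⟨hinj, LoopPf.pi_surj A f hf⟩, fun i k => hf i k⟩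
end

section
/- Let F̃ be the Lie algebra of the previous context (loop-type presentation of a symmetrizable Kac-Moody algebra 𝔤 of finite type). There is a unique Lie algebra isomorphism j : F̃ → 𝔤 ⊗ C[t, t⁻¹] such that j(x̃[k]) = x̄ ⊗ tᵏ for x ∈ {x_i^±, h_i} and k ∈ ℤ, where x̄_i^±, h̄_i are the Chevalley generators of 𝔤. -/
open TensorProduct

variable {n : ℕ}

/-- Generators `x̃_i^+[k]`, `x̃_i^-[k]`, `h̃_i[k]` of the current presentation `F̃`. -/
inductive FTGen (n : ℕ)
  | P (i : Fin n) (k : ℤ)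
  | M (i : Fin n) (k : ℤ)
  | Hh (i : Fin n) (k : ℤ)

/-- The defining relations of `F̃`: coefficients of `(z-w)[x̃_i^±(z), x̃_j^±(w)] = 0`,
`[h̃_i(z), h̃_j(w)] = 0`, `[h̃_i(z), x̃_j^±(w)] = ±a_{ij} δ(z/w) x̃_j^±(w)`,
`[x̃_i^+(z), x̃_j^-(w)] = δ_{ij} δ(z/w) h̃_i(z)`, and the field Serre relations. -/
def ftRels (A : Matrix (Fin n) (Fin n) ℤ) : Set (FreeLieAlgebra ℂ (FTGen n)) :=
  {z | ∃ (i j : Fin n) (k l : ℤ),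
      z = ⁅FreeLieAlgebra.of ℂ (FTGen.P i (k + 1)), FreeLieAlgebra.of ℂ (FTGen.P j l)⁆
        - ⁅FreeLieAlgebra.of ℂ (FTGen.P i k), FreeLieAlgebra.of ℂ (FTGen.P j (l + 1))⁆} ∪
  {z | ∃ (i j : Fin n) (k l : ℤ),
      z = ⁅FreeLieAlgebra.of ℂ (FTGen.M i (k + 1)), FreeLieAlgebra.of ℂ (FTGen.M j l)⁆
        - ⁅FreeLieAlgebra.of ℂ (FTGen.M i k), FreeLieAlgebra.of ℂ (FTGen.M j (l + 1))⁆} ∪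
  {z | ∃ (i j : Fin n) (k l : ℤ),
      z = ⁅FreeLieAlgebra.of ℂ (FTGen.Hh i k), FreeLieAlgebra.of ℂ (FTGen.Hh j l)⁆} ∪
  {z | ∃ (i j : Fin n) (k l : ℤ),
      z = ⁅FreeLieAlgebra.of ℂ (FTGen.Hh i k), FreeLieAlgebra.of ℂ (FTGen.P j l)⁆
        - (A i j : ℂ) • FreeLieAlgebra.of ℂ (FTGen.P j (k + l))} ∪
  {z | ∃ (i j : Fin n) (k l : ℤ),
      z = ⁅FreeLieAlgebra.of ℂ (FTGen.Hh i k), FreeLieAlgebra.of ℂ (FTGen.M j l)⁆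
        + (A i j : ℂ) • FreeLieAlgebra.of ℂ (FTGen.M j (k + l))} ∪
  {z | ∃ (i j : Fin n) (k l : ℤ),
      z = ⁅FreeLieAlgebra.of ℂ (FTGen.P i k), FreeLieAlgebra.of ℂ (FTGen.M j l)⁆
        - (if i = j then (1 : ℂ) else 0) • FreeLieAlgebra.of ℂ (FTGen.Hh i (k + l))} ∪
  {z | ∃ i j : Fin n, i ≠ j ∧ ∃ (ks : List ℤ) (l : ℤ), ks.length = (1 - A i j).toNat ∧
      z = ks.foldr (fun t acc => ⁅FreeLieAlgebra.of ℂ (FTGen.P i t), acc⁆)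
            (FreeLieAlgebra.of ℂ (FTGen.P j l))} ∪
  {z | ∃ i j : Fin n, i ≠ j ∧ ∃ (ks : List ℤ) (l : ℤ), ks.length = (1 - A i j).toNat ∧
      z = ks.foldr (fun t acc => ⁅FreeLieAlgebra.of ℂ (FTGen.M i t), acc⁆)
            (FreeLieAlgebra.of ℂ (FTGen.M j l))}

/-- The Lie algebra `F̃` of the current (loop-type) presentation. -/
def FT (A : Matrix (Fin n) (Fin n) ℤ) :=
  FreeLieAlgebra ℂ (FTGen n) ⧸
    LieSubmodule.lieSpan ℂ (FreeLieAlgebra ℂ (FTGen n)) (ftRels A)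

noncomputable instance (A : Matrix (Fin n) (Fin n) ℤ) : LieRing (FT A) :=
  inferInstanceAs (LieRing (FreeLieAlgebra ℂ (FTGen n) ⧸
    LieSubmodule.lieSpan ℂ (FreeLieAlgebra ℂ (FTGen n)) (ftRels A)))

noncomputable instance (A : Matrix (Fin n) (Fin n) ℤ) : LieAlgebra ℂ (FT A) :=
  inferInstanceAs (LieAlgebra ℂ (FreeLieAlgebra ℂ (FTGen n) ⧸
    LieSubmodule.lieSpan ℂ (FreeLieAlgebra ℂ (FTGen n)) (ftRels A)))

/-- The generators of `F̃`. -/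
noncomputable def ftX (A : Matrix (Fin n) (Fin n) ℤ) (g : FTGen n) : FT A :=
  LieSubmodule.Quotient.mk
    (N := LieSubmodule.lieSpan ℂ (FreeLieAlgebra ℂ (FTGen n)) (ftRels A))
    (FreeLieAlgebra.of ℂ g)

/-- Chevalley generators of the Kac–Moody (here: semisimple) Lie algebra of `A`. -/
noncomputable def kmE (A : Matrix (Fin n) (Fin n) ℤ) (i : Fin n) : Matrix.ToLieAlgebra ℂ A :=
  LieSubmodule.Quotient.mk (N := CartanMatrix.Relations.toIdeal ℂ A)
    (FreeLieAlgebra.of ℂ (CartanMatrix.Generators.E i))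

noncomputable def kmF (A : Matrix (Fin n) (Fin n) ℤ) (i : Fin n) : Matrix.ToLieAlgebra ℂ A :=
  LieSubmodule.Quotient.mk (N := CartanMatrix.Relations.toIdeal ℂ A)
    (FreeLieAlgebra.of ℂ (CartanMatrix.Generators.F i))

noncomputable def kmH (A : Matrix (Fin n) (Fin n) ℤ) (i : Fin n) : Matrix.ToLieAlgebra ℂ A :=
  LieSubmodule.Quotient.mk (N := CartanMatrix.Relations.toIdeal ℂ A)
    (FreeLieAlgebra.of ℂ (CartanMatrix.Generators.H i))

set_option linter.unusedSimpArgs false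
set_option linter.unusedSectionVars false

section Abstract

variable {L : Type*} [LieRing L] [LieAlgebra ℂ L]

/-- Abstract version of the relations. -/
structure Sys (A : Matrix (Fin n) (Fin n) ℤ) (P M H : Fin n → ℤ → L) : Prop where
  PP : ∀ i k l, ⁅P i k, P i l⁆ = 0
  MM : ∀ i k l, ⁅M i k, M i l⁆ = 0
  HH : ∀ i j k l, ⁅H i k, H j l⁆ = 0
  HP : ∀ i j k l, ⁅H i k, P j l⁆ = (A i j : ℂ) • P j (k + l)
  HM : ∀ i j k l, ⁅H i k, M j l⁆ = -((A i j : ℂ) • M j (k + l))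
  PM : ∀ i j k l, ⁅P i k, M j l⁆ = (if i = j then (1 : ℂ) else 0) • H i (k + l)
  SP : ∀ i j l, ∃ N : ℕ, ((LieAlgebra.ad ℂ L (P i 0)) ^ N) (P j l) = 0
  SM : ∀ i j l, ∃ N : ℕ, ((LieAlgebra.ad ℂ L (M i 0)) ^ N) (M j l) = 0
  gen : ∀ S : LieSubalgebra ℂ L, (∀ i k, P i k ∈ S) → (∀ i k, M i k ∈ S) →
    (∀ i k, H i k ∈ S) → ∀ x, x ∈ S

theorem Sys.swap {A : Matrix (Fin n) (Fin n) ℤ} {P M H : Fin n → ℤ → L} (s : Sys A P M H) :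
    Sys A M P (fun i k => - H i k) where
  PP := s.MM
  MM := s.PP
  HH := fun i j k l => by simp [s.HH]
  HP := fun i j k l => by simp [s.HM]
  HM := fun i j k l => by simp [s.HP]
  PM := fun i j k l => by
    rw [← lie_skew, s.PM]
    by_cases h : i = j
    · subst h; simp [add_comm]
    · simp [h, Ne.symm h]
  SP := s.SM
  SM := s.SP
  gen := fun S h1 h2 h3 => s.gen S h2 h1 (fun i k => by simpa using neg_mem (h3 i k))

/-- weight -/
noncomputable def wt (A : Matrix (Fin n) (Fin n) ℤ) (β : Fin n → ℤ) (i : Fin n) : ℂ :=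
  ((∑ j, A i j * β j : ℤ) : ℂ)

theorem wt_add (A : Matrix (Fin n) (Fin n) ℤ) (β γ : Fin n → ℤ) (i : Fin n) :
    wt A (β + γ) i = wt A β i + wt A γ i := by
  simp [wt, mul_add, Finset.sum_add_distrib]

theorem wt_neg (A : Matrix (Fin n) (Fin n) ℤ) (β : Fin n → ℤ) (i : Fin n) :
    wt A (-β) i = - wt A β i := by
  simp [wt]

theorem wt_single (A : Matrix (Fin n) (Fin n) ℤ) (j : Fin n) (c : ℤ) (i : Fin n) :
    wt A (Pi.single j c) i = A i j * c := by
  simp [wt, Pi.single_apply]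

/-- joint weight space -/
noncomputable def Wsp (A : Matrix (Fin n) (Fin n) ℤ) (h : Fin n → L) (β : Fin n → ℤ) :
    Submodule ℂ L :=
  ⨅ i, Module.End.eigenspace (LieAlgebra.ad ℂ L (h i)) (wt A β i)

theorem mem_Wsp {A : Matrix (Fin n) (Fin n) ℤ} {h : Fin n → L} {β : Fin n → ℤ} {x : L} :
    x ∈ Wsp A h β ↔ ∀ i, ⁅h i, x⁆ = wt A β i • x := by
  simp [Wsp, Submodule.mem_iInf, Module.End.mem_eigenspace_iff]

theorem lie_mem_Wsp {A : Matrix (Fin n) (Fin n) ℤ} {h : Fin n → L} {β γ : Fin n → ℤ} {x y : L}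
    (hx : x ∈ Wsp A h β) (hy : y ∈ Wsp A h γ) : ⁅x, y⁆ ∈ Wsp A h (β + γ) := by
  rw [mem_Wsp] at *
  intro i
  rw [leibniz_lie, hx, hy, wt_add, add_smul, smul_lie, lie_smul]

theorem wt_injective {A : Matrix (Fin n) (Fin n) ℤ} (hA : A.det ≠ 0) :
    Function.Injective (wt A) := by
  intro β γ h
  have h2 : A.mulVec (β - γ) = 0 := by
    ext i
    have := congrFun h i
    simp only [wt, Int.cast_inj] at this
    simp [Matrix.mulVec, dotProduct, mul_sub, this]
  have := Matrix.eq_zero_of_mulVec_eq_zero hA h2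
  exact sub_eq_zero.mp this

theorem Wsp_indep {A : Matrix (Fin n) (Fin n) ℤ} (hA : A.det ≠ 0) (h : Fin n → L)
    (hc : ∀ i j, ⁅h i, h j⁆ = 0) : iSupIndep (Wsp A h) := by
  have h1 := Module.End.independent_iInf_maxGenEigenspace_of_forall_mapsTo
    (f := fun i => LieAlgebra.ad ℂ L (h i)) (by
      intro i j φ
      apply Module.End.mapsTo_maxGenEigenspace_of_comm
      refine LinearMap.ext fun x => ?_
      have := leibniz_lie (h i) (h j) x
      rw [hc, zero_lie, zero_add] at this
      simpa using this.symm)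
  have h2 := h1.comp (wt_injective hA)
  refine h2.mono ?_
  intro β
  refine iInf_mono fun i => ?_
  exact (Module.End.genEigenspace _ _).mono (by simp)

/-- monomials -/
inductive Mon (P : Fin n → ℤ → L) : (Fin n → ℤ) → L → Prop
  | base (i : Fin n) (k : ℤ) : Mon P (Pi.single i 1) (P i k)
  | step (i : Fin n) (k : ℤ) (β : Fin n → ℤ) (y : L) (hy : Mon P β y) :
      Mon P (Pi.single i 1 + β) ⁅P i k, y⁆

theorem Mon.nonneg {P : Fin n → ℤ → L} {β : Fin n → ℤ} {y : L} (h : Mon P β y) (i : Fin n) :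
    0 ≤ β i := by
  induction h with
  | base j k => by_cases h : i = j <;> simp [Pi.single_apply, h]
  | step j k β y hy ih =>
    have : 0 ≤ (Pi.single j 1 : Fin n → ℤ) i := by by_cases h : i = j <;> simp [Pi.single_apply, h]
    simp only [Pi.add_apply]; omega

theorem Mon.pos {P : Fin n → ℤ → L} {β : Fin n → ℤ} {y : L} (h : Mon P β y) :
    ∃ i, 0 < β i := by
  cases h with
  | base j k => exact ⟨j, by simp⟩
  | step j k β y hy =>
    refine ⟨j, ?_⟩
    have := hy.nonneg j
    simp only [Pi.add_apply, Pi.single_eq_same]; omega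

variable {A : Matrix (Fin n) (Fin n) ℤ} {P M H : Fin n → ℤ → L}

theorem Sys.P_mem (s : Sys A P M H) (i : Fin n) (k : ℤ) :
    P i k ∈ Wsp A (fun i => H i 0) (Pi.single i 1) := by
  rw [mem_Wsp]; intro j; simp [s.HP, wt_single]

theorem Sys.M_mem (s : Sys A P M H) (i : Fin n) (k : ℤ) :
    M i k ∈ Wsp A (fun i => H i 0) (-Pi.single i 1) := by
  rw [mem_Wsp]; intro j; simp [s.HM, wt_neg, wt_single]

theorem Sys.H_mem (s : Sys A P M H) (i : Fin n) (k : ℤ) :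
    H i k ∈ Wsp A (fun i => H i 0) 0 := by
  rw [mem_Wsp]; intro j; simp [s.HH, wt]

theorem Sys.mon_mem (s : Sys A P M H) {β : Fin n → ℤ} {y : L} (h : Mon P β y) :
    y ∈ Wsp A (fun i => H i 0) β := by
  induction h with
  | base i k => exact s.P_mem i k
  | step i k β y hy ih => exact lie_mem_Wsp (s.P_mem i k) ih

theorem Wsp_neg (h : Fin n → L) (β : Fin n → ℤ) :
    Wsp A (fun i => - h i) β = Wsp A h (-β) := by
  ext x
  simp only [mem_Wsp, wt_neg, neg_smul, neg_lie]
  exact forall_congr' fun i => by rw [neg_eq_iff_eq_neg]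

theorem Sys.mon_single (s : Sys A P M H) {β : Fin n → ℤ} {y : L} (h : Mon P β y) :
    ∀ i c, β = Pi.single i c → (c = 1 ∧ ∃ k, y = P i k) ∨ y = 0 := by
  induction h with
  | base j k =>
    intro i c h
    have hj : j = i := by
      by_contra hne
      have := congrFun h j
      simp [Pi.single_apply, hne] at this
    subst hj
    have := congrFun h j
    simp at this
    exact Or.inl ⟨this.symm, k, rfl⟩
  | step j k β y hy ih =>
    intro i c h
    have hj : j = i := by
      by_contra hne
      have := congrFun h j
      have h2 := hy.nonneg j
      simp [Pi.single_apply, hne] at this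
      omega
    subst hj
    right
    have hb : β = Pi.single j (c - 1) := by
      rw [Pi.single_sub, ← h]; simp
    rcases ih j (c - 1) hb with ⟨_, k', rfl⟩ | rfl
    · exact s.PP _ _ _
    · simp

/-- span of monomials -/
def NN (P : Fin n → ℤ → L) : Submodule ℂ L := Submodule.span ℂ {y | ∃ β, Mon P β y}

/-- span of the Cartan part -/
def N0 (H : Fin n → ℤ → L) : Submodule ℂ L := Submodule.span ℂ {y | ∃ i k, y = H i k}

theorem N0_neg : N0 (fun i k => - H i k) = N0 H := by
  apply le_antisymm <;> refine Submodule.span_le.2 ?_ <;> rintro y ⟨i, k, rfl⟩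
  · exact neg_mem (Submodule.subset_span ⟨i, k, rfl⟩)
  · rw [← neg_neg (H i k)]; exact neg_mem (Submodule.subset_span ⟨i, k, rfl⟩)

theorem lie_span_mem {S : Set L} {T : Submodule ℂ L} (x : L) (h : ∀ y ∈ S, ⁅x, y⁆ ∈ T)
    {y : L} (hy : y ∈ Submodule.span ℂ S) : ⁅x, y⁆ ∈ T := by
  induction hy using Submodule.span_induction with
  | mem y hy => exact h y hy
  | zero => simp
  | add a b _ _ ha hb => rw [lie_add]; exact add_mem ha hb
  | smul c a _ ha => rw [lie_smul]; exact T.smul_mem _ ha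

theorem P_NN (i : Fin n) (k : ℤ) {y : L} (hy : y ∈ NN P) : ⁅P i k, y⁆ ∈ NN P :=
  lie_span_mem _ (by rintro y ⟨β, hy⟩; exact Submodule.subset_span ⟨_, Mon.step i k β y hy⟩) hy

theorem P_mem_NN (i : Fin n) (k : ℤ) : P i k ∈ NN P := Submodule.subset_span ⟨_, Mon.base i k⟩

theorem H_mem_N0 (i : Fin n) (k : ℤ) : H i k ∈ N0 H := Submodule.subset_span ⟨_, _, rfl⟩

theorem Sys.H_NN (s : Sys A P M H) (i : Fin n) (k : ℤ) {y : L} (hy : y ∈ NN P) :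
    ⁅H i k, y⁆ ∈ NN P := by
  refine lie_span_mem _ ?_ hy
  rintro y ⟨β, hy⟩
  induction hy with
  | base j l => rw [s.HP]; exact Submodule.smul_mem _ _ (P_mem_NN _ _)
  | step j l β y hy ih =>
    rw [leibniz_lie, s.HP, smul_lie]
    exact add_mem (Submodule.smul_mem _ _ (P_NN _ _ (Submodule.subset_span ⟨_, hy⟩)))
      (P_NN _ _ ih)

theorem Sys.P_N0 (s : Sys A P M H) (i : Fin n) (k : ℤ) {y : L} (hy : y ∈ N0 H) :
    ⁅P i k, y⁆ ∈ NN P := by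
  refine lie_span_mem _ ?_ hy
  rintro y ⟨j, l, rfl⟩
  rw [← lie_skew, s.HP]
  exact neg_mem (Submodule.smul_mem _ _ (P_mem_NN _ _))

theorem Sys.M_NN (s : Sys A P M H) (i : Fin n) (k : ℤ) {y : L} (hy : y ∈ NN P) :
    ⁅M i k, y⁆ ∈ N0 H ⊔ NN P := by
  refine lie_span_mem _ ?_ hy
  rintro y ⟨β, hy⟩
  induction hy with
  | base j l =>
    rw [← lie_skew, s.PM]
    exact Submodule.mem_sup_left (neg_mem (Submodule.smul_mem _ _ (H_mem_N0 _ _)))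
  | step j l β y hy ih =>
    rw [leibniz_lie, ← lie_skew (M i k), s.PM, neg_lie, smul_lie]
    refine Submodule.mem_sup_right (add_mem (neg_mem (Submodule.smul_mem _ _ ?_)) ?_)
    · exact s.H_NN _ _ (Submodule.subset_span ⟨_, hy⟩)
    · obtain ⟨a, ha, b, hb, hab⟩ := Submodule.mem_sup.1 ih
      rw [← hab, lie_add]
      exact add_mem (s.P_N0 _ _ ha) (P_NN _ _ hb)

theorem Sys.top (s : Sys A P M H) (x : L) : x ∈ N0 H ⊔ NN P ⊔ NN M := by
  set T := N0 H ⊔ NN P ⊔ NN M with hT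
  have h0 : ∀ {y}, y ∈ N0 H → y ∈ T :=
    fun h => Submodule.mem_sup_left (Submodule.mem_sup_left h)
  have hp : ∀ {y}, y ∈ NN P → y ∈ T :=
    fun h => Submodule.mem_sup_left (Submodule.mem_sup_right h)
  have hm : ∀ {y}, y ∈ NN M → y ∈ T := fun h => Submodule.mem_sup_right h
  have key : ∀ z : L, (∀ y ∈ N0 H, ⁅z, y⁆ ∈ T) → (∀ y ∈ NN P, ⁅z, y⁆ ∈ T) →
      (∀ y ∈ NN M, ⁅z, y⁆ ∈ T) → ∀ y ∈ T, ⁅z, y⁆ ∈ T := by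
    intro z h1 h2 h3 y hy
    obtain ⟨a, ha, b, hb, rfl⟩ := Submodule.mem_sup.1 hy
    obtain ⟨c, hc, d, hd, rfl⟩ := Submodule.mem_sup.1 ha
    rw [lie_add, lie_add]
    exact add_mem (add_mem (h1 _ hc) (h2 _ hd)) (h3 _ hb)
  have s' := s.swap
  have hall : ∀ z y : L, y ∈ T → ⁅z, y⁆ ∈ T := by
    intro z
    let S : LieSubalgebra ℂ L :=
      { carrier := {z | ∀ y ∈ T, ⁅z, y⁆ ∈ T}
        add_mem' := fun {a b} ha hb y hy => by
          rw [add_lie]; exact add_mem (ha y hy) (hb y hy)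
        zero_mem' := fun y hy => by simp
        smul_mem' := fun c a ha y hy => by
          rw [smul_lie]; exact T.smul_mem _ (ha y hy)
        lie_mem' := fun {a b} ha hb y hy => by
          rw [lie_lie]; exact sub_mem (ha _ (hb y hy)) (hb _ (ha y hy)) }
    refine s.gen S ?_ ?_ ?_ z
    · intro i k
      refine key _ (fun y hy => hp (s.P_N0 i k hy)) (fun y hy => hp (P_NN i k hy)) ?_
      intro y hy
      have := s'.M_NN i k hy
      rw [N0_neg] at this
      exact (sup_le (fun _ h => h0 h) (fun _ h => hm h) : N0 H ⊔ NN M ≤ T) this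
    · intro i k
      refine key _ (fun y hy => hm (s'.P_N0 i k (by rwa [N0_neg])))
        (fun y hy => Submodule.mem_sup_left (s.M_NN i k hy)) (fun y hy => hm (P_NN i k hy))
    · intro i k
      refine key _ ?_ (fun y hy => hp (s.H_NN i k hy)) ?_
      · intro y hy
        refine lie_span_mem _ ?_ hy
        rintro y ⟨j, l, rfl⟩
        rw [s.HH]; exact zero_mem _
      · intro y hy
        have := s'.H_NN i k hy
        rw [neg_lie, neg_mem_iff] at this
        exact hm this
  let S : LieSubalgebra ℂ L := { T with lie_mem' := fun {a b} _ hb => hall a b hb }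
  exact s.gen S (fun i k => hp (P_mem_NN i k)) (fun i k => hm (P_mem_NN i k))
    (fun i k => h0 (H_mem_N0 i k)) x

/-- spanning set of each weight space -/
def BB (P M H : Fin n → ℤ → L) (β : Fin n → ℤ) : Set L :=
  {y | Mon P β y ∨ Mon M (-β) y ∨ (β = 0 ∧ ∃ i k, y = H i k)}

theorem Sys.span_BB_le (s : Sys A P M H) (β : Fin n → ℤ) :
    Submodule.span ℂ (BB P M H β) ≤ Wsp A (fun i => H i 0) β := by
  refine Submodule.span_le.2 ?_
  rintro y (h | h | ⟨rfl, i, k, rfl⟩)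
  · exact s.mon_mem h
  · have := s.swap.mon_mem h
    rw [Wsp_neg (A := A) (fun i => H i 0)] at this
    simpa using this
  · exact s.H_mem i k

theorem Sys.iSup_BB (s : Sys A P M H) : ⨆ β, Submodule.span ℂ (BB P M H β) = ⊤ := by
  rw [eq_top_iff]
  intro x _
  have := s.top x
  refine (sup_le (sup_le ?_ ?_) ?_ :
    N0 H ⊔ NN P ⊔ NN M ≤ ⨆ β, Submodule.span ℂ (BB P M H β)) this <;> refine Submodule.span_le.2 ?_
  · rintro y ⟨i, k, rfl⟩
    exact Submodule.mem_iSup_of_mem 0 (Submodule.subset_span (Or.inr (Or.inr ⟨rfl, i, k, rfl⟩)))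
  · rintro y ⟨β, h⟩
    exact Submodule.mem_iSup_of_mem β (Submodule.subset_span (Or.inl h))
  · rintro y ⟨β, h⟩
    exact Submodule.mem_iSup_of_mem (-β) (Submodule.subset_span (Or.inr (Or.inl (by simpa using h))))

theorem Sys.iSup_Wsp (s : Sys A P M H) : ⨆ β, Wsp A (fun i => H i 0) β = ⊤ :=
  top_le_iff.1 (s.iSup_BB ▸ iSup_mono s.span_BB_le)

theorem Sys.Wsp_le (s : Sys A P M H) (hA : A.det ≠ 0) (β : Fin n → ℤ) {x : L}
    (hx : x ∈ Wsp A (fun i => H i 0) β) : x ∈ Submodule.span ℂ (BB P M H β) := by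
  have hind := Wsp_indep hA (fun i => H i 0) (fun i j => s.HH i j 0 0)
  have htop : x ∈ Submodule.span ℂ (BB P M H β) ⊔ ⨆ γ ≠ β, Submodule.span ℂ (BB P M H γ) := by
    have h1 : (⊤ : Submodule ℂ L) ≤
        Submodule.span ℂ (BB P M H β) ⊔ ⨆ γ ≠ β, Submodule.span ℂ (BB P M H γ) := by
      rw [← s.iSup_BB]
      refine iSup_le fun γ => ?_
      by_cases h : γ = β
      · subst h; exact le_sup_left
      · exact le_sup_of_le_right (le_iSup₂_of_le γ h le_rfl)
    exact h1 trivial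
  obtain ⟨a, ha, b, hb, hab⟩ := Submodule.mem_sup.1 htop
  have hb1 : b ∈ Wsp A (fun i => H i 0) β := by
    have : b = x - a := by rw [← hab]; simp
    rw [this]; exact sub_mem hx (s.span_BB_le β ha)
  have hb2 : b ∈ ⨆ γ ≠ β, Wsp A (fun i => H i 0) γ :=
    (iSup₂_mono fun γ _ => s.span_BB_le γ) hb
  have hb0 : b = 0 := by
    have := (hind β).le_bot ⟨hb1, hb2⟩
    simpa using this
  rw [← hab, hb0, add_zero]; exact ha

theorem Sys.sign (s : Sys A P M H) (hA : A.det ≠ 0) (β : Fin n → ℤ) {x : L}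
    (hx : x ∈ Wsp A (fun i => H i 0) β) (h0 : x ≠ 0) : (∀ i, 0 ≤ β i) ∨ (∀ i, β i ≤ 0) := by
  by_contra hc
  have h := s.Wsp_le hA β hx
  have : BB P M H β = ∅ := by
    ext y
    simp only [Set.mem_empty_iff_false, iff_false]
    rintro (h | h | ⟨rfl, _⟩)
    · exact hc (Or.inl h.nonneg)
    · exact hc (Or.inr fun i => by simpa using h.nonneg i)
    · exact hc (Or.inl fun i => le_rfl)
  rw [this] at h
  simp at h
  exact h0 h

theorem Sys.simple (s : Sys A P M H) (hA : A.det ≠ 0) (i : Fin n) (c : ℤ) (hc : 0 < c) {x : L}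
    (hx : x ∈ Wsp A (fun i => H i 0) (Pi.single i c)) :
    x ∈ Submodule.span ℂ (Set.range (P i)) := by
  have h := s.Wsp_le hA _ hx
  refine Submodule.span_le.2 ?_ h
  rintro y (h | h | ⟨h, _⟩)
  · rcases s.mon_single h i c rfl with ⟨_, k, rfl⟩ | rfl
    · exact Submodule.subset_span ⟨k, rfl⟩
    · exact zero_mem _
  · have := h.nonneg i
    simp at this; omega
  · have := congrFun h i
    simp at this; omega

theorem Sys.zero (s : Sys A P M H) (hA : A.det ≠ 0) {x : L}
    (hx : x ∈ Wsp A (fun i => H i 0) 0) : x ∈ N0 H := by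
  have h := s.Wsp_le hA _ hx
  refine Submodule.span_le.2 ?_ h
  rintro y (h | h | ⟨_, i, k, rfl⟩)
  · obtain ⟨i, hi⟩ := h.pos; simp at hi
  · obtain ⟨i, hi⟩ := h.pos; simp at hi
  · exact H_mem_N0 i k

theorem Sys.nilp (s : Sys A P M H) (i : Fin n) (x : L) :
    ∃ N : ℕ, ((LieAlgebra.ad ℂ L (P i 0)) ^ N) x = 0 := by
  rw [← LieSubalgebra.mem_engel_iff]
  refine s.gen _ ?_ ?_ ?_ x <;> intro j k <;> rw [LieSubalgebra.mem_engel_iff]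
  · exact s.SP i j k
  · refine ⟨3, ?_⟩
    have h : ⁅P i 0, H i k⁆ = -((A i i : ℂ) • P i k) := by rw [← lie_skew, s.HP]; simp
    by_cases hij : i = j
    · simp [pow_succ, s.PM, h, s.PP, hij.symm]
    · simp [pow_succ, s.PM, hij]
  · refine ⟨2, ?_⟩
    have h : ⁅P i 0, H j k⁆ = -((A j i : ℂ) • P i k) := by rw [← lie_skew, s.HP]; simp
    simp [pow_succ, h, s.PP]

end Abstract

section Descent

variable {L : Type*} [LieRing L] [LieAlgebra ℂ L]
variable {A : Matrix (Fin n) (Fin n) ℤ} {P M H : Fin n → ℤ → L}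

theorem pow_mem_Wsp {h : Fin n → L} {β γ : Fin n → ℤ} {x y : L}
    (hx : x ∈ Wsp A h γ) (hy : y ∈ Wsp A h β) (p : ℕ) :
    ((LieAlgebra.ad ℂ L x) ^ p) y ∈ Wsp A h (β + (p : ℤ) • γ) := by
  induction p with
  | zero => simpa using hy
  | succ p ih =>
    rw [pow_succ', Module.End.mul_apply, LieAlgebra.ad_apply]
    have := lie_mem_Wsp hx ih
    convert this using 2
    push_cast
    rw [add_smul, one_smul]; abel

theorem pow_mem_ideal (K : LieIdeal ℂ L) {x y : L} (hy : y ∈ K) (p : ℕ) :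
    ((LieAlgebra.ad ℂ L x) ^ p) y ∈ K := by
  induction p with
  | zero => simpa using hy
  | succ p ih =>
    rw [pow_succ', Module.End.mul_apply, LieAlgebra.ad_apply]
    exact lie_mem_right ℂ L K _ _ ih

theorem Sys.reflect (s : Sys A P M H) (hdiag : ∀ i, A i i = 2) (K : LieIdeal ℂ L)
    {β : Fin n → ℤ} {v : L} (hv : v ∈ Wsp A (fun i => H i 0) β) (hK : v ∈ K) (h0 : v ≠ 0)
    (i : Fin n) (m : ℕ) (hm : (m : ℤ) = ∑ j, A i j * β j) (hpos : 0 < m) :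
    ∃ w, w ≠ 0 ∧ w ∈ K ∧ w ∈ Wsp A (fun i => H i 0) (β + (-(m : ℤ)) • Pi.single i 1) := by
  have hHv : ⁅H i 0, v⁆ = (m : ℂ) • v := by
    have := mem_Wsp.1 hv i
    rw [this, wt, ← hm]; simp
  have hH : H i 0 ≠ 0 := by
    intro h
    rw [h, zero_lie, eq_comm, smul_eq_zero] at hHv
    rcases hHv with h | h
    · have : m = 0 := by exact_mod_cast h
      omega
    · exact h0 h
  have t : IsSl2Triple (H i 0) (P i 0) (M i 0) :=
    { h_ne_zero := hH
      lie_e_f := by simp [s.PM]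
      lie_h_e_nsmul := by
        rw [s.HP, hdiag, ← Nat.cast_smul_eq_nsmul ℂ]; simp
      lie_h_f_nsmul := by
        rw [s.HM, hdiag, ← Nat.cast_smul_eq_nsmul ℂ]; simp }
  obtain ⟨p, hp1, hp2⟩ := Nat.exists_not_and_succ_of_not_zero_of_exists
    (p := fun N => ((LieAlgebra.ad ℂ L (P i 0)) ^ N) v = 0) (by simpa using h0) (s.nilp i v)
  have hpW := pow_mem_Wsp (s.P_mem i 0) hv p
  have hpK := pow_mem_ideal K (x := P i 0) hK p
  set u := ((LieAlgebra.ad ℂ L (P i 0)) ^ p) v with hu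
  have hprim : t.HasPrimitiveVectorWith u ((m + 2 * p : ℕ) : ℂ) :=
    { ne_zero := hp1
      lie_h := by
        have := mem_Wsp.1 hpW i
        rw [this, wt_add]
        congr 1
        have e1 : wt A β i = m := by rw [wt, ← hm]; simp
        rw [e1, ← Pi.single_smul, wt_single, hdiag]
        push_cast; simp
      lie_e := by
        rw [pow_succ', Module.End.mul_apply, LieAlgebra.ad_apply] at hp2
        exact hp2 }
  have hne := hprim.pow_toEnd_f_ne_zero_of_eq_nat rfl (i := m + p) (by omega)
  refine ⟨((LieAlgebra.ad ℂ L (M i 0)) ^ (m + p)) u, hne, pow_mem_ideal K hpK _, ?_⟩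
  have := pow_mem_Wsp (s.M_mem i 0) hpW (m + p)
  convert this using 2
  ext j
  simp only [Pi.add_apply, Pi.smul_apply, Pi.neg_apply, smul_eq_mul]
  push_cast; ring

theorem Sys.descent (s : Sys A P M H) (hdiag : ∀ i, A i i = 2) (hA : A.det ≠ 0)
    (hpd : ∀ β : Fin n → ℤ, β ≠ 0 → (∀ i, 0 ≤ β i) → ∃ i, 0 < ∑ j, A i j * β j)
    (K : LieIdeal ℂ L)
    (hK : ∀ i, ∀ x ∈ Submodule.span ℂ (Set.range (P i)), x ∈ K → x = 0) (N : ℕ) :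
    ∀ β : Fin n → ℤ, (∀ i, 0 ≤ β i) → β ≠ 0 → ∑ i, β i ≤ N →
      ∀ x ∈ Wsp A (fun i => H i 0) β, x ∈ K → x = 0 := by
  induction N with
  | zero =>
    intro β hβ h0 hs
    exfalso
    apply h0
    ext i
    have := (Finset.sum_eq_zero_iff_of_nonneg (fun i _ => hβ i)).1
      (le_antisymm (by simpa using hs) (Finset.sum_nonneg fun i _ => hβ i)) i (Finset.mem_univ i)
    simpa using this
  | succ N ih =>
    intro β hβ h0 hs x hx hxK
    by_contra hx0
    obtain ⟨i, hi⟩ := hpd β h0 hβ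
    by_cases hsing : β = Pi.single i (β i)
    · have hpos : 0 < β i := by
        rcases (hβ i).lt_or_eq with h | h
        · exact h
        · rw [← h] at hsing; simp at hsing; exact absurd hsing h0
      rw [hsing] at hx
      exact hx0 (hK i x (s.simple hA i _ hpos hx) hxK)
    · obtain ⟨j, hj⟩ := Function.ne_iff.1 hsing
      have hji : j ≠ i := by rintro rfl; simp at hj
      simp only [Pi.single_eq_of_ne hji] at hj
      have hjpos : 0 < β j := lt_of_le_of_ne (hβ j) (Ne.symm hj)
      obtain ⟨m, hm⟩ := Int.eq_ofNat_of_zero_le hi.le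
      obtain ⟨w, hw0, hwK, hw⟩ := s.reflect hdiag K hx hxK hx0 i m hm.symm (by omega)
      have hγj : (β + (-(m : ℤ)) • Pi.single i 1 : Fin n → ℤ) j = β j := by
        simp [Pi.single_eq_of_ne hji]
      refine hw0 (ih _ ?_ ?_ ?_ w hw hwK)
      · rcases s.sign hA _ hw hw0 with h | h
        · exact h
        · have := h j
          rw [hγj] at this; omega
      · intro h
        have := congrFun h j
        rw [hγj] at this; simp at this; omega
      · have : ∑ k, (β + (-(m : ℤ)) • Pi.single i 1 : Fin n → ℤ) k = ∑ k, β k - m := by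
          simp [Finset.sum_add_distrib, Finset.sum_neg_distrib, ← Finset.mul_sum, sub_eq_add_neg]
        rw [this]
        push_cast at hs
        omega

theorem Sys.ideal_Wsp (s : Sys A P M H) (hdiag : ∀ i, A i i = 2) (hA : A.det ≠ 0)
    (hpd : ∀ β : Fin n → ℤ, β ≠ 0 → (∀ i, 0 ≤ β i) → ∃ i, 0 < ∑ j, A i j * β j)
    (K : LieIdeal ℂ L)
    (hP : ∀ i, ∀ x ∈ Submodule.span ℂ (Set.range (P i)), x ∈ K → x = 0)
    (hM : ∀ i, ∀ x ∈ Submodule.span ℂ (Set.range (M i)), x ∈ K → x = 0)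
    (hH : ∀ x ∈ N0 H, x ∈ K → x = 0)
    (β : Fin n → ℤ) (x : L) (hx : x ∈ Wsp A (fun i => H i 0) β) (hxK : x ∈ K) : x = 0 := by
  by_contra hx0
  by_cases hb : β = 0
  · subst hb
    exact hx0 (hH x (s.zero hA hx) hxK)
  rcases s.sign hA β hx hx0 with h | h
  · exact hx0 (s.descent hdiag hA hpd K hP (∑ i, β i).toNat β h hb (Int.self_le_toNat _) x hx hxK)
  · refine hx0 (s.swap.descent hdiag hA hpd K hM (∑ i, (-β) i).toNat (-β) (fun i => by simpa using h i)
      (by simpa using hb) (Int.self_le_toNat _) x ?_ hxK)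
    rw [Wsp_neg (A := A) (fun i => H i 0)]
    simpa using hx

theorem Sys.injective (s : Sys A P M H) (hdiag : ∀ i, A i i = 2) (hA : A.det ≠ 0)
    (hpd : ∀ β : Fin n → ℤ, β ≠ 0 → (∀ i, 0 ≤ β i) → ∃ i, 0 < ∑ j, A i j * β j)
    {G : Type*} [LieRing G] [LieAlgebra ℂ G] (f : L →ₗ⁅ℂ⁆ G)
    (hP : ∀ i, ∀ x ∈ Submodule.span ℂ (Set.range (P i)), f x = 0 → x = 0)
    (hM : ∀ i, ∀ x ∈ Submodule.span ℂ (Set.range (M i)), f x = 0 → x = 0)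
    (hH : ∀ x ∈ N0 H, f x = 0 → x = 0) : Function.Injective f := by
  rw [injective_iff_map_eq_zero]
  intro x hx
  have hx' : x ∈ ⨆ β, Wsp A (fun i => H i 0) β := by rw [s.iSup_Wsp]; trivial
  classical
  rw [Submodule.mem_iSup_iff_exists_finsupp] at hx'
  obtain ⟨g, hg, hsum⟩ := hx'
  have hind := Wsp_indep hA (fun i => f (H i 0)) (fun i j => by
    rw [← LieHom.map_lie, s.HH, map_zero])
  rw [iSupIndep_iff_finsetSum_eq_zero_imp_eq_zero] at hind
  have hz := hind g.support (fun β => f (g β)) (by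
    intro β _
    rw [mem_Wsp]
    intro i
    rw [← LieHom.map_lie, mem_Wsp.1 (hg β) i, map_smul]) (by
    rw [← map_sum]
    rw [Finsupp.sum] at hsum
    rw [hsum, hx])
  rw [← hsum]
  refine Finset.sum_eq_zero fun β hβ => ?_
  refine s.ideal_Wsp hdiag hA hpd f.ker (fun i x h1 h2 => hP i x h1 (by simpa using h2))
    (fun i x h1 h2 => hM i x h1 (by simpa using h2))
    (fun x h1 h2 => hH x h1 (by simpa using h2)) β _ (hg β) ?_
  simpa using hz β hβ

end Descent

section Rigid

variable {L : Type*} [LieRing L] [LieAlgebra ℂ L]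
variable {A : Matrix (Fin n) (Fin n) ℤ} {P M H : Fin n → ℤ → L}

theorem Sys.P_transfer (s : Sys A P M H) (hdiag : ∀ i, A i i = 2) (i : Fin n) (c : ℂ)
    (h : c • P i 0 = 0) (k : ℤ) : c • P i k = 0 := by
  have h1 : ⁅H i k, c • P i 0⁆ = 0 := by rw [h, lie_zero]
  rw [lie_smul, s.HP, hdiag, smul_comm, smul_eq_zero] at h1
  rcases h1 with h1 | h1
  · norm_num at h1
  · simpa using h1

theorem Sys.H_transfer (s : Sys A P M H) (hdiag : ∀ i, A i i = 2) (hA : A.det ≠ 0)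
    (hzero : ∀ i j, A i j = 0 ↔ A j i = 0) (c : Fin n → ℂ)
    (h : ∑ i, c i • H i 0 = 0) (k : ℤ) : ∑ i, c i • H i k = 0 := by
  classical
  -- indices where the system degenerates
  have hHP : ∀ i, P i 0 = 0 → ∀ l, H i l = 0 := by
    intro i hi l
    have := s.PM i i 0 l
    rw [hi, zero_lie] at this
    simpa using this.symm
  have hAz : ∀ i j, P i 0 = 0 → P j 0 ≠ 0 → A i j = 0 := by
    intro i j hi hj
    have := s.HP i j 0 0
    rw [hHP i hi, zero_lie, eq_comm, smul_eq_zero] at this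
    rcases this with h | h
    · exact_mod_cast h
    · exact absurd (by simpa using h) hj
  let c' : Fin n → ℂ := fun i => if P i 0 = 0 then 0 else c i
  have hsum : ∀ l, ∑ i, c i • H i l = ∑ i, c' i • H i l := by
    intro l
    refine Finset.sum_congr rfl fun i _ => ?_
    by_cases hi : P i 0 = 0
    · simp [hHP i hi l]
    · simp [c', hi]
  rw [hsum] at h ⊢
  have hc : c' = 0 := by
    have hdet : (A.map (Int.cast : ℤ → ℂ)).det ≠ 0 := by
      have : (A.map (Int.cast : ℤ → ℂ)).det = (A.det : ℂ) := by
        have := (Int.castRingHom ℂ).map_det A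
        simpa using this.symm
      rw [this]; exact_mod_cast hA
    refine Matrix.eq_zero_of_vecMul_eq_zero hdet ?_
    ext j
    simp only [Matrix.vecMul, dotProduct, Matrix.map_apply, Pi.zero_apply]
    by_cases hj : P j 0 = 0
    · refine Finset.sum_eq_zero fun i _ => ?_
      by_cases hi : P i 0 = 0
      · simp [c', hi]
      · have := (hzero j i).1 (hAz j i hj hi)
        simp [this]
    · have h1 : ⁅∑ i, c' i • H i 0, P j 0⁆ = 0 := by rw [h, zero_lie]
      simp only [LieRing.of_associative_ring_bracket, sum_lie, smul_lie, s.HP, smul_smul,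
        add_zero, ← Finset.sum_smul] at h1
      exact (smul_eq_zero.1 h1).resolve_right hj
  simp [hc]

theorem Sys.bijCond (s : Sys A P M H) (hdiag : ∀ i, A i i = 2) (hA : A.det ≠ 0)
    (hzero : ∀ i j, A i j = 0 ↔ A j i = 0)
    (hpd : ∀ β : Fin n → ℤ, β ≠ 0 → (∀ i, 0 ≤ β i) → ∃ i, 0 < ∑ j, A i j * β j)
    {G : Type*} [LieRing G] [LieAlgebra ℂ G] (f : L →ₗ⁅ℂ⁆ G) (Ψ : ℤ → G →ₗ[ℂ] L)
    (hP : ∀ i k l, Ψ k (f (P i l)) = if l = k then P i 0 else 0)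
    (hM : ∀ i k l, Ψ k (f (M i l)) = if l = k then M i 0 else 0)
    (hH : ∀ i k l, Ψ k (f (H i l)) = if l = k then H i 0 else 0) : Function.Injective f := by
  have aux : ∀ {P M H : Fin n → ℤ → L}, Sys A P M H →
      (∀ i k l, Ψ k (f (P i l)) = if l = k then P i 0 else 0) →
      ∀ i, ∀ x ∈ Submodule.span ℂ (Set.range (P i)), f x = 0 → x = 0 := by
    intro P M H s hP i x hx hfx
    obtain ⟨c, rfl⟩ := Finsupp.mem_span_range_iff_exists_finsupp.1 hx
    refine Finset.sum_eq_zero fun k hk => ?_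
    refine s.P_transfer hdiag i _ ?_ k
    have h1 : Ψ k (f (c.sum fun i_1 a => a • P i i_1)) = 0 := by rw [hfx, map_zero]
    simp only [Finsupp.sum, map_sum, map_smul, hP, smul_ite, smul_zero] at h1
    rw [Finset.sum_ite_eq'] at h1
    rwa [if_pos hk] at h1
  refine s.injective hdiag hA hpd f (aux s hP) (aux s.swap hM) ?_
  intro x hx hfx
  have hx' : x ∈ LinearMap.range (Finsupp.lsum ℂ (fun k : ℤ =>
      (∑ i, (LinearMap.proj i : (Fin n → ℂ) →ₗ[ℂ] ℂ).smulRight (H i k)))) := by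
    refine Submodule.span_le.2 ?_ hx
    rintro y ⟨i, k, rfl⟩
    refine ⟨Finsupp.single k (Pi.single i 1), ?_⟩
    simp [LinearMap.sum_apply, Pi.single_apply]
  obtain ⟨c, rfl⟩ := hx'
  rw [Finsupp.lsum_apply] at hfx ⊢
  refine Finset.sum_eq_zero fun k hk => ?_
  have h2 : ∑ i, c k i • H i 0 = 0 := by
    have h1 : Ψ k (f (c.sum fun k a => (∑ i, (LinearMap.proj i : (Fin n → ℂ) →ₗ[ℂ] ℂ).smulRight
      (H i k)) a)) = 0 := by
      rw [hfx, map_zero]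
    simp only [Finsupp.sum, map_sum, map_smul, hH, smul_ite, smul_zero, LinearMap.sum_apply,
      LinearMap.smulRight_apply, LinearMap.proj_apply] at h1
    rw [Finset.sum_comm] at h1
    simp only [Finset.sum_ite_eq'] at h1
    rw [← h1]
    refine Finset.sum_congr rfl fun i _ => ?_
    rw [if_pos hk]
  have := s.H_transfer hdiag hA hzero (c k) h2 k
  simpa [LinearMap.sum_apply] using this

theorem det_ne_of_posDef (A : Matrix (Fin n) (Fin n) ℤ) (d : Fin n → ℤ)
    (hfin : Matrix.PosDef (fun i j : Fin n => ((d i * A i j : ℤ) : ℝ))) : A.det ≠ 0 := by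
  have h1 := hfin.det_pos
  have h2 : (fun i j : Fin n => ((d i * A i j : ℤ) : ℝ)) =
      (Int.castRingHom ℝ).mapMatrix (Matrix.diagonal d * A) := by
    ext i j; simp [Matrix.diagonal_mul]
  have h3 : Matrix.det (fun i j : Fin n => ((d i * A i j : ℤ) : ℝ)) =
      (((Matrix.diagonal d * A).det : ℤ) : ℝ) := by
    rw [h2, ← RingHom.map_det]; simp
  rw [h3] at h1
  intro h
  rw [Matrix.det_mul, h] at h1
  simp at h1

theorem pd_of_posDef (A : Matrix (Fin n) (Fin n) ℤ) (d : Fin n → ℤ) (hd : ∀ i, 0 < d i)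
    (hfin : Matrix.PosDef (fun i j : Fin n => ((d i * A i j : ℤ) : ℝ)))
    (β : Fin n → ℤ) (h0 : β ≠ 0) (hβ : ∀ i, 0 ≤ β i) : ∃ i, 0 < ∑ j, A i j * β j := by
  by_contra hc
  push Not at hc
  have h1 := hfin.dotProduct_mulVec_pos (x := fun i => (β i : ℝ)) (by
    intro h
    apply h0
    ext i
    have := congrFun h i
    simpa using this)
  have h2 : (star fun i => (β i : ℝ)) ⬝ᵥ
      Matrix.mulVec (fun i j : Fin n => ((d i * A i j : ℤ) : ℝ)) (fun i => (β i : ℝ)) =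
      ((∑ i, β i * d i * ∑ j, A i j * β j : ℤ) : ℝ) := by
    simp only [dotProduct, Matrix.mulVec, Pi.star_apply, star_trivial]
    push_cast
    refine Finset.sum_congr rfl fun i _ => ?_
    rw [Finset.mul_sum, Finset.mul_sum]
    exact Finset.sum_congr rfl fun j _ => by ring
  rw [h2] at h1
  have h3 : (∑ i, β i * d i * ∑ j, A i j * β j : ℤ) ≤ 0 :=
    Finset.sum_nonpos fun i _ =>
      mul_nonpos_of_nonneg_of_nonpos (mul_nonneg (hβ i) (hd i).le) (hc i)
  have h4 : (0 : ℤ) < ∑ i, β i * d i * ∑ j, A i j * β j := by exact_mod_cast h1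
  omega

end Rigid

section Concrete

/-- Lift of a morphism to the quotient by the ideal generated by a set. -/
noncomputable def quotLift {F G : Type*} [LieRing F] [LieAlgebra ℂ F] [LieRing G] [LieAlgebra ℂ G]
    (S : Set F) (f : F →ₗ⁅ℂ⁆ G) (h : ∀ z ∈ S, f z = 0) :
    (F ⧸ LieSubmodule.lieSpan ℂ F S) →ₗ⁅ℂ⁆ G :=
  { (LieSubmodule.lieSpan ℂ F S).toSubmodule.liftQ (f : F →ₗ[ℂ] G) (by
      have h1 : LieSubmodule.lieSpan ℂ F S ≤ f.ker :=
        LieSubmodule.lieSpan_le.2 fun z hz => by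
          simpa using h z hz
      intro x hx
      have := h1 hx
      simpa using this) with
    map_lie' := by
      intro x y
      induction x using Quotient.inductionOn' with | _ x
      induction y using Quotient.inductionOn' with | _ y
      exact f.map_lie x y }

theorem quotLift_mk {F G : Type*} [LieRing F] [LieAlgebra ℂ F] [LieRing G] [LieAlgebra ℂ G]
    (S : Set F) (f : F →ₗ⁅ℂ⁆ G) (h : ∀ z ∈ S, f z = 0) (x : F) :
    quotLift S f h (LieSubmodule.Quotient.mk x) = f x := rfl

variable (A : Matrix (Fin n) (Fin n) ℤ)

/-- The projection onto `FT`. -/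
noncomputable def ftMk : FreeLieAlgebra ℂ (FTGen n) →ₗ⁅ℂ⁆ FT A where
  toFun x := LieSubmodule.Quotient.mk
    (N := LieSubmodule.lieSpan ℂ (FreeLieAlgebra ℂ (FTGen n)) (ftRels A)) x
  map_add' _ _ := rfl
  map_smul' _ _ := rfl
  map_lie' := rfl

theorem ftMk_of (g : FTGen n) : ftMk A (FreeLieAlgebra.of ℂ g) = ftX A g := rfl

theorem ftMk_surj : Function.Surjective (ftMk A) := by
  intro x
  induction x using Quotient.inductionOn' with | _ x
  exact ⟨x, rfl⟩

theorem ftMk_rel {z : FreeLieAlgebra ℂ (FTGen n)} (hz : z ∈ ftRels A) : ftMk A z = 0 :=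
  LieSubmodule.Quotient.mk_eq_zero'.2 (LieSubmodule.subset_lieSpan hz)

/-- The projection onto the Serre algebra. -/
noncomputable def kmMk : FreeLieAlgebra ℂ (CartanMatrix.Generators (Fin n)) →ₗ⁅ℂ⁆
    Matrix.ToLieAlgebra ℂ A where
  toFun x := LieSubmodule.Quotient.mk (N := CartanMatrix.Relations.toIdeal ℂ A) x
  map_add' _ _ := rfl
  map_smul' _ _ := rfl
  map_lie' := rfl

theorem kmMk_surj : Function.Surjective (kmMk A) := by
  intro x
  induction x using Quotient.inductionOn' with | _ x
  exact ⟨x, rfl⟩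

theorem kmMk_rel {z : FreeLieAlgebra ℂ (CartanMatrix.Generators (Fin n))}
    (hz : z ∈ CartanMatrix.Relations.toSet ℂ A) : kmMk A z = 0 :=
  LieSubmodule.Quotient.mk_eq_zero'.2 (LieSubmodule.subset_lieSpan hz)

theorem gen_of_free {X G : Type*} [LieRing G] [LieAlgebra ℂ G]
    (π : FreeLieAlgebra ℂ X →ₗ⁅ℂ⁆ G) (hπ : Function.Surjective π) (S : LieSubalgebra ℂ G)
    (h : ∀ x, π (FreeLieAlgebra.of ℂ x) ∈ S) (y : G) : y ∈ S := by
  obtain ⟨z, rfl⟩ := hπ y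
  let g : FreeLieAlgebra ℂ X →ₗ⁅ℂ⁆ S := FreeLieAlgebra.lift ℂ fun x => ⟨_, h x⟩
  have : S.incl.comp g = π := by
    apply FreeLieAlgebra.hom_ext
    intro x
    simp [g]
  rw [← this]
  exact (g z).2

theorem map_ad_pow {F G : Type*} [LieRing F] [LieAlgebra ℂ F] [LieRing G] [LieAlgebra ℂ G]
    (f : F →ₗ⁅ℂ⁆ G) (x y : F) (m : ℕ) :
    f (((LieAlgebra.ad ℂ F x) ^ m) y) = ((LieAlgebra.ad ℂ G (f x)) ^ m) (f y) := by
  induction m with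
  | zero => simp
  | succ m ih => simp [pow_succ', ih]

theorem foldr_replicate {F ι : Type*} [LieRing F] [LieAlgebra ℂ F] (x : ι → F) (t : ι) (y : F)
    (m : ℕ) : (List.replicate m t).foldr (fun t acc => ⁅x t, acc⁆) y =
      ((LieAlgebra.ad ℂ F (x t)) ^ m) y := by
  induction m with
  | zero => simp
  | succ m ih => simp [pow_succ', List.replicate_succ, ih]

theorem map_foldr {F G ι : Type*} [LieRing F] [LieAlgebra ℂ F] [LieRing G] [LieAlgebra ℂ G]
    (f : F →ₗ⁅ℂ⁆ G) (x : ι → F) (y : F) (ks : List ι) :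
    f (ks.foldr (fun t acc => ⁅x t, acc⁆) y) = ks.foldr (fun t acc => ⁅f (x t), acc⁆) (f y) := by
  induction ks with
  | nil => rfl
  | cons a l ih => simp [ih]

theorem shift_eq {X : Type*} (f : ℤ → ℤ → X) (h : ∀ k l, f (k + 1) l = f k (l + 1)) (k l : ℤ) :
    f k l = f 0 (k + l) := by
  induction k using Int.induction_on generalizing l with
  | zero => simp
  | succ k ih => rw [h, ih]; congr 1; ring
  | pred k ih =>
    have := h (-(k : ℤ) - 1) (l - 1)
    rw [sub_add_cancel, sub_add_cancel] at this
    rw [← this, ih]; congr 1; ring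

theorem shift_lie_zero {F : Type*} [LieRing F] [LieAlgebra ℂ F] (x : ℤ → F)
    (h : ∀ k l, ⁅x (k + 1), x l⁆ = ⁅x k, x (l + 1)⁆) (k l : ℤ) : ⁅x k, x l⁆ = 0 := by
  have h1 := shift_eq (fun k l => ⁅x k, x l⁆) h k l
  have h2 := shift_eq (fun k l => ⁅x k, x l⁆) h l k
  rw [add_comm l k, ← h1, ← lie_skew, eq_comm] at h2
  have h3 : (2 : ℂ) • ⁅x k, x l⁆ = 0 := by
    rw [two_smul]; exact add_eq_zero_iff_eq_neg.2 h2
  exact (smul_eq_zero.1 h3).resolve_left (by norm_num)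

theorem ft_sys (A : Matrix (Fin n) (Fin n) ℤ) :
    Sys A (fun i k => ftX A (FTGen.P i k)) (fun i k => ftX A (FTGen.M i k))
      (fun i k => ftX A (FTGen.Hh i k)) := by
  have hPP : ∀ i k l, ⁅ftX A (FTGen.P i k), ftX A (FTGen.P i l)⁆ = 0 := by
    intro i
    refine shift_lie_zero (fun k => ftX A (FTGen.P i k)) fun k l => ?_
    have := ftMk_rel A (z := _) (Or.inl (Or.inl (Or.inl (Or.inl (Or.inl (Or.inl (Or.inl
      ⟨i, i, k, l, rfl⟩)))))))
    rw [map_sub, LieHom.map_lie, LieHom.map_lie, sub_eq_zero] at this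
    exact this
  have hMM : ∀ i k l, ⁅ftX A (FTGen.M i k), ftX A (FTGen.M i l)⁆ = 0 := by
    intro i
    refine shift_lie_zero (fun k => ftX A (FTGen.M i k)) fun k l => ?_
    have := ftMk_rel A (z := _) (Or.inl (Or.inl (Or.inl (Or.inl (Or.inl (Or.inl (Or.inr
      ⟨i, i, k, l, rfl⟩)))))))
    rw [map_sub, LieHom.map_lie, LieHom.map_lie, sub_eq_zero] at this
    exact this
  refine
  { PP := hPP
    MM := hMM
    HH := fun i j k l => ?_
    HP := fun i j k l => ?_
    HM := fun i j k l => ?_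
    PM := fun i j k l => ?_
    SP := fun i j l => ?_
    SM := fun i j l => ?_
    gen := fun S h1 h2 h3 => ?_ }
  · have := ftMk_rel A (z := _) (Or.inl (Or.inl (Or.inl (Or.inl (Or.inl (Or.inr
      ⟨i, j, k, l, rfl⟩))))))
    rw [LieHom.map_lie] at this
    exact this
  · have := ftMk_rel A (z := _) (Or.inl (Or.inl (Or.inl (Or.inl (Or.inr
      ⟨i, j, k, l, rfl⟩)))))
    rw [map_sub, map_smul, LieHom.map_lie, sub_eq_zero] at this
    exact this
  · have := ftMk_rel A (z := _) (Or.inl (Or.inl (Or.inl (Or.inr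
      ⟨i, j, k, l, rfl⟩))))
    rw [map_add, map_smul, LieHom.map_lie, add_eq_zero_iff_eq_neg] at this
    exact this
  · have := ftMk_rel A (z := _) (Or.inl (Or.inl (Or.inr
      ⟨i, j, k, l, rfl⟩)))
    rw [map_sub, map_smul, LieHom.map_lie, sub_eq_zero] at this
    exact this
  · by_cases hij : i = j
    · subst hij
      exact ⟨1, by simp [hPP]⟩
    · refine ⟨(1 - A i j).toNat, ?_⟩
      have := ftMk_rel A (z := _) (Or.inl (Or.inr ⟨i, j, hij,
        List.replicate (1 - A i j).toNat 0, l, by simp, rfl⟩))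
      rw [map_foldr, foldr_replicate (fun t => ftMk A (FreeLieAlgebra.of ℂ (FTGen.P i t)))] at this
      exact this
  · by_cases hij : i = j
    · subst hij
      exact ⟨1, by simp [hMM]⟩
    · refine ⟨(1 - A i j).toNat, ?_⟩
      have := ftMk_rel A (z := _) (Or.inr ⟨i, j, hij,
        List.replicate (1 - A i j).toNat 0, l, by simp, rfl⟩)
      rw [map_foldr, foldr_replicate (fun t => ftMk A (FreeLieAlgebra.of ℂ (FTGen.M i t)))] at this
      exact this
  · refine gen_of_free (ftMk A) (ftMk_surj A) S ?_
    rintro (⟨i, k⟩ | ⟨i, k⟩ | ⟨i, k⟩)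
    · exact h1 i k
    · exact h2 i k
    · exact h3 i k

end Concrete

section Maps

theorem ft_serreP (A : Matrix (Fin n) (Fin n) ℤ) (i j : Fin n) (hij : i ≠ j) (k l : ℤ) :
    ((LieAlgebra.ad ℂ (FT A) (ftX A (FTGen.P i k))) ^ (1 - A i j).toNat) (ftX A (FTGen.P j l))
      = 0 := by
  have := ftMk_rel A (z := _) (Or.inl (Or.inr ⟨i, j, hij,
    List.replicate (1 - A i j).toNat k, l, by simp, rfl⟩))
  rw [map_foldr, foldr_replicate (fun t => ftMk A (FreeLieAlgebra.of ℂ (FTGen.P i t)))] at this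
  exact this

theorem ft_serreM (A : Matrix (Fin n) (Fin n) ℤ) (i j : Fin n) (hij : i ≠ j) (k l : ℤ) :
    ((LieAlgebra.ad ℂ (FT A) (ftX A (FTGen.M i k))) ^ (1 - A i j).toNat) (ftX A (FTGen.M j l))
      = 0 := by
  have := ftMk_rel A (z := _) (Or.inr ⟨i, j, hij,
    List.replicate (1 - A i j).toNat k, l, by simp, rfl⟩)
  rw [map_foldr, foldr_replicate (fun t => ftMk A (FreeLieAlgebra.of ℂ (FTGen.M i t)))] at this
  exact this

theorem toNat_succ {a : ℤ} (h : a ≤ 0) : (1 - a).toNat = (-a).toNat + 1 := by omega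

/-- Images of the Serre generators. -/
noncomputable def phiGen (A : Matrix (Fin n) (Fin n) ℤ) :
    CartanMatrix.Generators (Fin n) → FT A
  | .H i => ftX A (FTGen.Hh i 0)
  | .E i => ftX A (FTGen.P i 0)
  | .F i => ftX A (FTGen.M i 0)

theorem phi_rel (A : Matrix (Fin n) (Fin n) ℤ) (hdiag : ∀ i, A i i = 2)
    (hoff : ∀ i j, i ≠ j → A i j ≤ 0) :
    ∀ z ∈ CartanMatrix.Relations.toSet ℂ A, FreeLieAlgebra.lift ℂ (phiGen A) z = 0 := by
  have s := ft_sys A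
  rintro z (((((⟨⟨i, j⟩, rfl⟩ | ⟨⟨i, j⟩, rfl⟩) | ⟨⟨i, j⟩, rfl⟩) | ⟨⟨i, j⟩, rfl⟩) | ⟨⟨i, j⟩, rfl⟩) |
    ⟨⟨i, j⟩, rfl⟩)
  · simp [CartanMatrix.Relations.HH, phiGen, s.HH]
  · by_cases hij : i = j
    · subst hij
      simp [CartanMatrix.Relations.EF, phiGen, s.PM]
    · simp [CartanMatrix.Relations.EF, phiGen, s.PM, hij]
  · simp [CartanMatrix.Relations.HE, phiGen, s.HP, Int.cast_smul_eq_zsmul]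
  · simp [CartanMatrix.Relations.HF, phiGen, s.HM, Int.cast_smul_eq_zsmul]
  · simp only [CartanMatrix.Relations.adE, Function.uncurry, map_ad_pow, LieHom.map_lie,
      Function.comp_apply, FreeLieAlgebra.lift_of_apply, phiGen]
    by_cases hij : i = j
    · subst hij; simp
    · have := ft_serreP A i j hij 0 0
      rw [toNat_succ (hoff i j hij), pow_succ, Module.End.mul_apply, LieAlgebra.ad_apply] at this
      exact this
  · simp only [CartanMatrix.Relations.adF, Function.uncurry, map_ad_pow, LieHom.map_lie,
      Function.comp_apply, FreeLieAlgebra.lift_of_apply, phiGen]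
    by_cases hij : i = j
    · subst hij; simp
    · have := ft_serreM A i j hij 0 0
      rw [toNat_succ (hoff i j hij), pow_succ, Module.End.mul_apply, LieAlgebra.ad_apply] at this
      exact this

/-- The map from the Serre algebra to `FT`. -/
noncomputable def phi (A : Matrix (Fin n) (Fin n) ℤ) (hdiag : ∀ i, A i i = 2)
    (hoff : ∀ i j, i ≠ j → A i j ≤ 0) : Matrix.ToLieAlgebra ℂ A →ₗ⁅ℂ⁆ FT A :=
  quotLift (CartanMatrix.Relations.toSet ℂ A) (FreeLieAlgebra.lift ℂ (phiGen A))
    (phi_rel A hdiag hoff)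

section phi
variable (A : Matrix (Fin n) (Fin n) ℤ) (hdiag : ∀ i, A i i = 2)
    (hoff : ∀ i j, i ≠ j → A i j ≤ 0) (i : Fin n)

theorem phi_E : phi A hdiag hoff (kmE A i) = ftX A (FTGen.P i 0) :=
  (quotLift_mk _ _ (phi_rel A hdiag hoff) _).trans (FreeLieAlgebra.lift_of_apply _ _)

theorem phi_F : phi A hdiag hoff (kmF A i) = ftX A (FTGen.M i 0) :=
  (quotLift_mk _ _ (phi_rel A hdiag hoff) _).trans (FreeLieAlgebra.lift_of_apply _ _)

theorem phi_H : phi A hdiag hoff (kmH A i) = ftX A (FTGen.Hh i 0) :=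
  (quotLift_mk _ _ (phi_rel A hdiag hoff) _).trans (FreeLieAlgebra.lift_of_apply _ _)

end phi

section km
variable (A : Matrix (Fin n) (Fin n) ℤ) (i j : Fin n)

theorem km_HH : ⁅kmH A i, kmH A j⁆ = 0 := by
  have := kmMk_rel A (z := _) (Or.inl (Or.inl (Or.inl (Or.inl (Or.inl ⟨(i, j), rfl⟩)))))
  exact this

theorem km_EF : ⁅kmE A i, kmF A j⁆ = (if i = j then (1 : ℂ) else 0) • kmH A i := by
  have := kmMk_rel A (z := _) (Or.inl (Or.inl (Or.inl (Or.inl (Or.inr ⟨(i, j), rfl⟩)))))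
  by_cases hij : i = j
  · subst hij
    simp only [CartanMatrix.Relations.EF, Function.uncurry, if_true, map_sub, sub_eq_zero] at this
    simp only [if_true, one_smul]
    exact this
  · simp only [CartanMatrix.Relations.EF, Function.uncurry, if_neg hij] at this
    simp only [if_neg hij, zero_smul]
    exact this

theorem km_HE : ⁅kmH A i, kmE A j⁆ = (A i j : ℂ) • kmE A j := by
  have := kmMk_rel A (z := _) (Or.inl (Or.inl (Or.inl (Or.inr ⟨(i, j), rfl⟩))))
  simp only [CartanMatrix.Relations.HE, Function.uncurry, map_sub, sub_eq_zero, map_zsmul] at this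
  rw [Int.cast_smul_eq_zsmul]
  exact this

theorem km_HF : ⁅kmH A i, kmF A j⁆ = -((A i j : ℂ) • kmF A j) := by
  have := kmMk_rel A (z := _) (Or.inl (Or.inl (Or.inr ⟨(i, j), rfl⟩)))
  simp only [CartanMatrix.Relations.HF, Function.uncurry, map_add, add_eq_zero_iff_eq_neg,
    map_zsmul] at this
  rw [Int.cast_smul_eq_zsmul]
  exact this

theorem km_serreE (h : A i j ≤ 0) :
    ((LieAlgebra.ad ℂ _ (kmE A i)) ^ (1 - A i j).toNat) (kmE A j) = 0 := by
  have := kmMk_rel A (z := _) (Or.inl (Or.inr ⟨(i, j), rfl⟩))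
  simp only [CartanMatrix.Relations.adE, Function.uncurry, map_ad_pow, LieHom.map_lie] at this
  rw [toNat_succ h, pow_succ, Module.End.mul_apply, LieAlgebra.ad_apply]
  exact this

theorem km_serreF (h : A i j ≤ 0) :
    ((LieAlgebra.ad ℂ _ (kmF A i)) ^ (1 - A i j).toNat) (kmF A j) = 0 := by
  have := kmMk_rel A (z := _) (Or.inr ⟨(i, j), rfl⟩)
  simp only [CartanMatrix.Relations.adF, Function.uncurry, map_ad_pow, LieHom.map_lie] at this
  rw [toNat_succ h, pow_succ, Module.End.mul_apply, LieAlgebra.ad_apply]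
  exact this

end km

section loop

variable {L : Type*} [LieRing L] [LieAlgebra ℂ L]

theorem loop_lie (k l : ℤ) (x y : L) :
    ⁅loopOf L k x, loopOf L l y⁆ = loopOf L (k + l) ⁅x, y⁆ := by
  have h : ⁅(LaurentPolynomial.T k : LaurentPolynomial ℂ) ⊗ₜ[ℂ] x,
      (LaurentPolynomial.T l : LaurentPolynomial ℂ) ⊗ₜ[ℂ] y⁆ =
      (LaurentPolynomial.T (k + l) : LaurentPolynomial ℂ) ⊗ₜ[ℂ] ⁅x, y⁆ := by
    rw [LieAlgebra.ExtendScalars.bracket_tmul, LaurentPolynomial.T_add]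
  exact h

/-- The identity as a linear map. -/
noncomputable def loopToTensor (L : Type*) [LieRing L] [LieAlgebra ℂ L] :
    LoopAlg L ≃ₗ[ℂ] (LaurentPolynomial ℂ) ⊗[ℂ] L :=
  { RestrictScalars.addEquiv ℂ (LaurentPolynomial ℂ) ((LaurentPolynomial ℂ) ⊗[ℂ] L) with
    map_smul' := fun c x =>
      (RestrictScalars.addEquiv_map_smul ℂ (LaurentPolynomial ℂ) _ c x).trans
        (algebraMap_smul (LaurentPolynomial ℂ) c _) }

theorem loopToTensor_loopOf (k : ℤ) (x : L) :
    loopToTensor L (loopOf L k x) = LaurentPolynomial.T k ⊗ₜ[ℂ] x := rfl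

theorem loopOf_eq (k : ℤ) (x : L) :
    loopOf L k x = (loopToTensor L).symm (LaurentPolynomial.T k ⊗ₜ[ℂ] x) := rfl

theorem loopOf_add (k : ℤ) (x y : L) : loopOf L k (x + y) = loopOf L k x + loopOf L k y := by
  simp only [loopOf_eq, TensorProduct.tmul_add, map_add]

theorem loopOf_smul (k : ℤ) (c : ℂ) (x : L) : loopOf L k (c • x) = c • loopOf L k x := by
  simp only [loopOf_eq, TensorProduct.tmul_smul, map_smul]

theorem loopOf_zero (k : ℤ) : loopOf L k 0 = 0 := by
  simp only [loopOf_eq, TensorProduct.tmul_zero, map_zero]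

theorem loopOf_neg (k : ℤ) (x : L) : loopOf L k (-x) = - loopOf L k x := by
  simp only [loopOf_eq, TensorProduct.tmul_neg, map_neg]

/-- Coefficient of `tᵏ`. -/
noncomputable def loopCoef (L : Type*) [LieRing L] [LieAlgebra ℂ L] (k : ℤ) :
    LoopAlg L →ₗ[ℂ] L :=
  (TensorProduct.lid ℂ L).toLinearMap ∘ₗ
    LinearMap.rTensor L ((Finsupp.lapply k : (ℤ →₀ ℂ) →ₗ[ℂ] ℂ) ∘ₗ
      (AddMonoidAlgebra.coeffLinearEquiv ℂ (S := ℂ) (M := ℤ)).toLinearMap) ∘ₗ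
    (loopToTensor L).toLinearMap

theorem loopCoef_loopOf (k l : ℤ) (x : L) :
    loopCoef L k (loopOf L l x) = if l = k then x else 0 := by
  have hT : (LaurentPolynomial.T l : LaurentPolynomial ℂ).coeff k = if l = k then 1 else 0 := by
    change (Finsupp.single l (1 : ℂ)) k = _
    rw [Finsupp.single_apply]
  have h1 : loopCoef L k (loopOf L l x) =
      (LaurentPolynomial.T l : LaurentPolynomial ℂ).coeff k • x := rfl
  rw [h1, hT]
  by_cases h : l = k
  · rw [if_pos h, if_pos h, one_smul]
  · rw [if_neg h, if_neg h, zero_smul]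

theorem loop_mem (S : Submodule ℂ (LoopAlg L)) (h : ∀ k x, loopOf L k x ∈ S) (y : LoopAlg L) :
    y ∈ S := by
  obtain ⟨z, rfl⟩ := (loopToTensor L).symm.surjective y
  induction z using TensorProduct.induction_on with
  | zero => simp
  | add a b ha hb => rw [map_add]; exact add_mem ha hb
  | tmul p x =>
    have key : ∀ (k : ℤ) (a : ℂ), (loopToTensor L).symm
        ((LaurentPolynomial.C a * LaurentPolynomial.T k) ⊗ₜ[ℂ] x) ∈ S := by
      intro k a
      have : (LaurentPolynomial.C a * LaurentPolynomial.T k : LaurentPolynomial ℂ) =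
        a • LaurentPolynomial.T k := by
        rw [LaurentPolynomial.smul_eq_C_mul]
      rw [this, ← TensorProduct.smul_tmul', map_smul]
      exact S.smul_mem _ (h k x)
    induction p using LaurentPolynomial.induction_on with
    | h_C a => simpa using key 0 a
    | h_add hp hq => rw [TensorProduct.add_tmul, map_add]; exact add_mem hp hq
    | h_C_mul_T n a _ => exact key _ a
    | h_C_mul_T_Z n a _ => exact key _ a

theorem loop_foldr (x y : L) (ks : List ℤ) (l : ℤ) :
    ks.foldr (fun t acc => ⁅loopOf L t x, acc⁆) (loopOf L l y) =
      loopOf L (ks.sum + l) (((LieAlgebra.ad ℂ L x) ^ ks.length) y) := by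
  induction ks with
  | nil => simp
  | cons a t ih =>
    rw [List.foldr_cons, ih, loop_lie, List.sum_cons, List.length_cons, pow_succ',
      Module.End.mul_apply, LieAlgebra.ad_apply, add_assoc]

end loop

/-- Images of the generators of `FT`. -/
noncomputable def jGen (A : Matrix (Fin n) (Fin n) ℤ) :
    FTGen n → LoopAlg (Matrix.ToLieAlgebra ℂ A)
  | .P i k => loopOf _ k (kmE A i)
  | .M i k => loopOf _ k (kmF A i)
  | .Hh i k => loopOf _ k (kmH A i)

theorem j_rel (A : Matrix (Fin n) (Fin n) ℤ) (hoff : ∀ i j, i ≠ j → A i j ≤ 0) :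
    ∀ z ∈ ftRels A, FreeLieAlgebra.lift ℂ (jGen A) z = 0 := by
  rintro z (((((((⟨i, j, k, l, rfl⟩ | ⟨i, j, k, l, rfl⟩) | ⟨i, j, k, l, rfl⟩) | ⟨i, j, k, l, rfl⟩) |
    ⟨i, j, k, l, rfl⟩) | ⟨i, j, k, l, rfl⟩) | ⟨i, j, hij, ks, l, hks, rfl⟩) |
    ⟨i, j, hij, ks, l, hks, rfl⟩)
  · simp only [map_sub, LieHom.map_lie, FreeLieAlgebra.lift_of_apply, jGen, loop_lie]
    rw [add_right_comm, add_assoc, sub_self]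
  · simp only [map_sub, LieHom.map_lie, FreeLieAlgebra.lift_of_apply, jGen, loop_lie]
    rw [add_right_comm, add_assoc, sub_self]
  · simp only [LieHom.map_lie, FreeLieAlgebra.lift_of_apply, jGen, loop_lie, km_HH, loopOf_zero]
  · simp only [map_sub, map_smul, LieHom.map_lie, FreeLieAlgebra.lift_of_apply, jGen, loop_lie,
      km_HE, loopOf_smul, sub_self]
  · simp only [map_add, map_smul, LieHom.map_lie, FreeLieAlgebra.lift_of_apply, jGen, loop_lie,
      km_HF, loopOf_smul, loopOf_neg, neg_add_cancel]
  · simp only [map_sub, map_smul, LieHom.map_lie, FreeLieAlgebra.lift_of_apply, jGen, loop_lie,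
      km_EF, loopOf_smul, sub_self]
  · rw [map_foldr]
    simp only [FreeLieAlgebra.lift_of_apply, jGen]
    rw [loop_foldr, hks, km_serreE A i j (hoff i j hij), loopOf_zero]
  · rw [map_foldr]
    simp only [FreeLieAlgebra.lift_of_apply, jGen]
    rw [loop_foldr, hks, km_serreF A i j (hoff i j hij), loopOf_zero]

/-- The map `j`. -/
noncomputable def jMap (A : Matrix (Fin n) (Fin n) ℤ) (hoff : ∀ i j, i ≠ j → A i j ≤ 0) :
    FT A →ₗ⁅ℂ⁆ LoopAlg (Matrix.ToLieAlgebra ℂ A) :=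
  quotLift (ftRels A) (FreeLieAlgebra.lift ℂ (jGen A)) (j_rel A hoff)

theorem jMap_X (A : Matrix (Fin n) (Fin n) ℤ) (hoff : ∀ i j, i ≠ j → A i j ≤ 0) (g : FTGen n) :
    jMap A hoff (ftX A g) = jGen A g :=
  (quotLift_mk _ _ (j_rel A hoff) _).trans (FreeLieAlgebra.lift_of_apply _ _)

theorem jMap_surj (A : Matrix (Fin n) (Fin n) ℤ) (hdiag : ∀ i, A i i = 2)
    (hoff : ∀ i j, i ≠ j → A i j ≤ 0) : Function.Surjective (jMap A hoff) := by
  intro y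
  suffices h : y ∈ LinearMap.range (jMap A hoff : FT A →ₗ[ℂ] _) by
    obtain ⟨x, hx⟩ := h
    exact ⟨x, hx⟩
  refine loop_mem _ ?_ y
  let S : LieSubalgebra ℂ (Matrix.ToLieAlgebra ℂ A) :=
    { carrier := {x | ∀ k, ∃ z, jMap A hoff z = loopOf _ k x}
      add_mem' := fun {a b} ha hb k => by
        obtain ⟨u, hu⟩ := ha k
        obtain ⟨v, hv⟩ := hb k
        exact ⟨u + v, by rw [map_add, hu, hv, loopOf_add]⟩
      zero_mem' := fun k => ⟨0, by rw [map_zero, loopOf_zero]⟩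
      smul_mem' := fun c a ha k => by
        obtain ⟨u, hu⟩ := ha k
        exact ⟨c • u, by rw [map_smul, hu, loopOf_smul]⟩
      lie_mem' := fun {a b} ha hb k => by
        obtain ⟨u, hu⟩ := ha k
        obtain ⟨v, hv⟩ := hb 0
        exact ⟨⁅u, v⁆, by rw [LieHom.map_lie, hu, hv, loop_lie, add_zero]⟩ }
  intro k x
  have hx : x ∈ S := by
    refine gen_of_free (kmMk A) (kmMk_surj A) S ?_ x
    rintro (i | i | i) k
    · exact ⟨_, jMap_X A hoff (FTGen.Hh i k)⟩
    · exact ⟨_, jMap_X A hoff (FTGen.P i k)⟩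
    · exact ⟨_, jMap_X A hoff (FTGen.M i k)⟩
  obtain ⟨z, hz⟩ := hx k
  exact ⟨z, hz⟩

end Maps


/-- Let `𝔤` be the finite-dimensional semisimple Lie algebra of a Cartan
matrix `A` of finite type, with Chevalley generators `x̄_i^±, h̄_i`.  There is a unique Lie
algebra isomorphism `j : F̃ → 𝔤 ⊗ ℂ[t,t⁻¹]` such that `j(x̃[k]) = x̄ ⊗ tᵏ` for
`x ∈ {x_i^±, h_i}` and `k ∈ ℤ`. -/
theorem stmt13 (A : Matrix (Fin n) (Fin n) ℤ)
    (hdiag : ∀ i, A i i = 2)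
    (hoff : ∀ i j, i ≠ j → A i j ≤ 0)
    (hzero : ∀ i j, A i j = 0 ↔ A j i = 0)
    (d : Fin n → ℤ) (hd : ∀ i, 0 < d i)
    (hsymm : ∀ i j, d i * A i j = d j * A j i)
    (hfin : Matrix.PosDef (fun i j : Fin n => ((d i * A i j : ℤ) : ℝ))) :
    ∃! e : FT A ≃ₗ⁅ℂ⁆ LoopAlg (Matrix.ToLieAlgebra ℂ A),
      ∀ (i : Fin n) (k : ℤ),
        e (ftX A (FTGen.P i k)) = loopOf (Matrix.ToLieAlgebra ℂ A) k (kmE A i) ∧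
        e (ftX A (FTGen.M i k)) = loopOf (Matrix.ToLieAlgebra ℂ A) k (kmF A i) ∧
        e (ftX A (FTGen.Hh i k)) = loopOf (Matrix.ToLieAlgebra ℂ A) k (kmH A i) := by
  have s := ft_sys A
  have hinj : Function.Injective (jMap A hoff) := by
    refine s.bijCond hdiag (det_ne_of_posDef A d hfin) hzero (pd_of_posDef A d hd hfin)
      (jMap A hoff)
      (fun k => (phi A hdiag hoff : Matrix.ToLieAlgebra ℂ A →ₗ[ℂ] FT A) ∘ₗ loopCoef _ k) ?_ ?_ ?_
    · intro i k l
      rw [jMap_X, jGen, LinearMap.comp_apply, loopCoef_loopOf]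
      split_ifs
      · exact phi_E A hdiag hoff i
      · exact map_zero _
    · intro i k l
      rw [jMap_X, jGen, LinearMap.comp_apply, loopCoef_loopOf]
      split_ifs
      · exact phi_F A hdiag hoff i
      · exact map_zero _
    · intro i k l
      rw [jMap_X, jGen, LinearMap.comp_apply, loopCoef_loopOf]
      split_ifs
      · exact phi_H A hdiag hoff i
      · exact map_zero _
  refine ⟨LieEquiv.ofBijective (jMap A hoff) ⟨hinj, jMap_surj A hdiag hoff⟩, ?_, ?_⟩
  · intro i k
    exact ⟨jMap_X A hoff (FTGen.P i k), jMap_X A hoff (FTGen.M i k),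
      jMap_X A hoff (FTGen.Hh i k)⟩
  · intro e he
    apply LieEquiv.ext
    intro x
    let S : LieSubalgebra ℂ (FT A) :=
      { carrier := {x | e x = jMap A hoff x}
        add_mem' := fun {a b} (ha : e a = _) (hb : e b = _) => by
          change e (a + b) = jMap A hoff (a + b)
          rw [map_add, map_add, ha, hb]
        zero_mem' := by
          change e 0 = jMap A hoff 0
          rw [map_zero, map_zero]
        smul_mem' := fun c a (ha : e a = _) => by
          change e (c • a) = jMap A hoff (c • a)
          rw [map_smul, map_smul, ha]
        lie_mem' := fun {a b} (ha : e a = _) (hb : e b = _) => by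
          change e ⁅a, b⁆ = jMap A hoff ⁅a, b⁆
          rw [LieEquiv.map_lie, LieHom.map_lie, ha, hb] }
    exact s.gen S (fun i k => (he i k).1.trans (jMap_X A hoff (FTGen.P i k)).symm)
      (fun i k => (he i k).2.1.trans (jMap_X A hoff (FTGen.M i k)).symm)
      (fun i k => (he i k).2.2.trans (jMap_X A hoff (FTGen.Hh i k)).symm) x
end
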